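/- arXiv:math/0508370 — 3 statements merged into one kernel-verified Lean document; each statement's English description precedes it below -/
import Mathlib

section
/- Let G be a group, and let Z and U be nonzero rings such that the group ring ZG is a subring of U and every nonzero element of ZG is invertible in U. Suppose that the trivial left ZG-module Z admits a flat resolution of length at most one; that is, there is an exact sequence of left ZG-modules 0 → F₁ → F₀ → Z → 0 with F₀ and F₁ flat (equivalently, the homological dimension of G over Z is at most 1; equivalently, the augmentation ideal of ZG is flat as a left ZG-module). Then every subgroup of G generated by two elements is a free group. -/
/-- The augmentation ring homomorphism `ZG → Z`, sending each group element
to `1`. -/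
noncomputable def augmentationRingHom (Z : Type) [Ring Z] (G : Type) [Group G] :
    MonoidAlgebra Z G →+* Z :=
  MonoidAlgebra.liftNCRingHom (RingHom.id Z) 1 (fun _ _ => Commute.one_right _)

/-- The trivial left `ZG`-module `Z`. -/
def TrivialModule (Z : Type) [Ring Z] (G : Type) [Group G] : Type := Z

instance (Z : Type) [Ring Z] (G : Type) [Group G] :
    AddCommGroup (TrivialModule Z G) :=
  inferInstanceAs (AddCommGroup Z)

noncomputable instance (Z : Type) [Ring Z] (G : Type) [Group G] :
    Module (MonoidAlgebra Z G) (TrivialModule Z G) :=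
  Module.compHom Z (augmentationRingHom Z G)

/-- `b : N → M → T` realizes the tensor product `N ⊗_A M` of a right
`A`-module `N` (a left `Aᵐᵒᵖ`-module) and a left `A`-module `M` over the
abelian group `T`: it is biadditive, `A`-balanced, and universal among
biadditive `A`-balanced maps into abelian groups. -/
def IsBalancedProduct (A : Type) [Ring A] (N : Type) [AddCommGroup N]
    [Module Aᵐᵒᵖ N] (M : Type) [AddCommGroup M] [Module A M]
    (T : Type) [AddCommGroup T] (b : N → M → T) : Prop :=
  (∀ n n' m, b (n + n') m = b n m + b n' m) ∧
  (∀ n m m', b n (m + m') = b n m + b n m') ∧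
  (∀ (n : N) (a : A) (m : M), b (MulOpposite.op a • n) m = b n (a • m)) ∧
  ∀ (T' : Type) (_ : AddCommGroup T') (b' : N → M → T'),
    (∀ n n' m, b' (n + n') m = b' n m + b' n' m) →
    (∀ n m m', b' n (m + m') = b' n m + b' n m') →
    (∀ (n : N) (a : A) (m : M), b' (MulOpposite.op a • n) m = b' n (a • m)) →
    ∃! g : T →+ T', ∀ n m, g (b n m) = b' n m

/-- A left `A`-module `M` is flat if tensoring with it preserves injectivity
of maps of right `A`-modules: for every injective map `j : N → N'` of right
`A`-modules and realizations `T = N ⊗_A M`, `T' = N' ⊗_A M`, the induced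
additive map `T → T'` is injective. -/
def IsFlatLeftModule (A : Type) [Ring A] (M : Type) [AddCommGroup M]
    [Module A M] : Prop :=
  ∀ (N N' : Type) (_ : AddCommGroup N) (_ : Module Aᵐᵒᵖ N)
    (_ : AddCommGroup N') (_ : Module Aᵐᵒᵖ N') (j : N →ₗ[Aᵐᵒᵖ] N'),
    Function.Injective j →
    ∀ (T T' : Type) (_ : AddCommGroup T) (_ : AddCommGroup T')
      (b : N → M → T) (b' : N' → M → T'),
      IsBalancedProduct A N M T b → IsBalancedProduct A N' M T' b' →
      ∀ h : T →+ T', (∀ n m, h (b n m) = b' (j n) m) → Function.Injective h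

/-- The edges `(i, g)`, joining `g` and `s i * g`, of the left Cayley graph on the generators `s`
with exactly one endpoint in `A`. -/
def coboundary {G ι : Type*} [Group G] (s : ι → G) (A : Set G) : Set (ι × G) :=
  {e | ¬ (e.2 ∈ A ↔ s e.1 * e.2 ∈ A)}

/-- The right translate `A g⁻¹`. -/
def rightTranslate {G : Type*} [Group G] (A : Set G) (g : G) : Set G := {k | k * g ∈ A}

/-- An infinite, co-infinite set with finite coboundary. -/
structure IsCut {G ι : Type*} [Group G] (s : ι → G) (A : Set G) : Prop where
  infinite : A.Infinite
  compl_infinite : Aᶜ.Infinite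
  finite_coboundary : (coboundary s A).Finite

/-- A cut whose coboundary is as small as possible. -/
structure IsNarrow {G ι : Type*} [Group G] (s : ι → G) (A : Set G) : Prop where
  isCut : IsCut s A
  ncard_le : ∀ B, IsCut s B → (coboundary s A).ncard ≤ (coboundary s B).ncard

/-- Two sets cross if all four of their corners are nonempty. -/
def Crosses {X : Type*} (A B : Set X) : Prop :=
  (A ∩ B).Nonempty ∧ (A ∩ Bᶜ).Nonempty ∧ (Aᶜ ∩ B).Nonempty ∧ (Aᶜ ∩ Bᶜ).Nonempty

section Coboundary

variable {G ι : Type*} [Group G] {s : ι → G} {A B C D : Set G}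

theorem coboundary_compl : coboundary s Aᶜ = coboundary s A := by
  ext e; simp only [coboundary, Set.mem_ofPred_eq, Set.mem_compl_iff]; tauto

theorem coboundary_inter_union_subset :
    coboundary s (A ∩ B) ∪ coboundary s (A ∪ B) ⊆ coboundary s A ∪ coboundary s B := by
  intro e
  simp only [coboundary, Set.mem_ofPred_eq, Set.mem_union, Set.mem_inter_iff]; tauto

theorem coboundary_inter_inter_subset :
    coboundary s (A ∩ B) ∩ coboundary s (A ∪ B) ⊆ coboundary s A ∩ coboundary s B := by
  intro e
  simp only [coboundary, Set.mem_ofPred_eq, Set.mem_union, Set.mem_inter_iff]; tauto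

theorem coboundary_symmDiff :
    coboundary s (symmDiff A B) = symmDiff (coboundary s A) (coboundary s B) := by
  ext e
  simp only [coboundary, Set.mem_ofPred_eq, Set.mem_symmDiff]; tauto

theorem Set.Finite.coboundary [Finite ι] (hA : A.Finite) : (coboundary s A).Finite := by
  refine ((Set.finite_univ (α := ι)).prod hA).union
    (((Set.finite_univ (α := ι)).prod hA).image fun e => (e.1, (s e.1)⁻¹ * e.2)) |>.subset ?_
  rintro ⟨i, g⟩ h
  by_cases hg : g ∈ A
  · exact Or.inl ⟨trivial, hg⟩
  · refine Or.inr ⟨(i, s i * g), ⟨trivial, ?_⟩, by simp⟩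
    simp only [_root_.coboundary, Set.mem_ofPred_eq] at h
    tauto

theorem finite_coboundary_of_symmDiff [Finite ι] (hA : (coboundary s A).Finite)
    (h : (symmDiff A B).Finite) : (coboundary s B).Finite := by
  have := coboundary_symmDiff (s := s) (A := A) (B := symmDiff A B)
  rw [symmDiff_symmDiff_cancel_left] at this
  rw [this]
  exact hA.symmDiff h.coboundary

theorem eq_empty_or_univ_of_mul_mem_iff (hs : Subgroup.closure (Set.range s) = ⊤)
    (h : ∀ i g, g ∈ A ↔ s i * g ∈ A) : A = ∅ ∨ A = Set.univ := by
  have key : ∀ k : G, ∀ g, g ∈ A ↔ k * g ∈ A := by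
    intro k
    have hk : k ∈ Subgroup.closure (Set.range s) := hs ▸ Subgroup.mem_top k
    induction hk using Subgroup.closure_induction with
    | mem _ hx => obtain ⟨i, rfl⟩ := hx; exact h i
    | one => simp
    | mul a b _ _ ha hb => intro g; rw [hb, ha, mul_assoc]
    | inv a _ ha => intro g; rw [ha (a⁻¹ * g), mul_inv_cancel_left]
  rcases A.eq_empty_or_nonempty with h0 | ⟨a, ha⟩
  · exact Or.inl h0
  · refine Or.inr (Set.eq_univ_of_forall fun g => ?_)
    simpa using (key (g * a⁻¹) a).1 ha

theorem eq_empty_or_univ_of_coboundary_eq_empty (hs : Subgroup.closure (Set.range s) = ⊤)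
    (h : coboundary s A = ∅) : A = ∅ ∨ A = Set.univ := by
  refine eq_empty_or_univ_of_mul_mem_iff hs fun i g => ?_
  by_contra hc
  exact (h ▸ (show (i, g) ∈ coboundary s A from hc) : (i, g) ∈ (∅ : Set (ι × G)))

/-- Finite coboundary means almost invariant under all left translations. -/
theorem finite_mul_mem_xor (hs : Subgroup.closure (Set.range s) = ⊤)
    (hA : (coboundary s A).Finite) (k : G) : {g | ¬ (g ∈ A ↔ k * g ∈ A)}.Finite := by
  have hk : k ∈ Subgroup.closure (Set.range s) := hs ▸ Subgroup.mem_top k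
  induction hk using Subgroup.closure_induction with
  | mem _ hx =>
    obtain ⟨i, rfl⟩ := hx
    exact (hA.image Prod.snd).subset fun g hg => ⟨(i, g), hg, rfl⟩
  | one => simp
  | mul a b _ _ ha hb =>
    refine (hb.union (ha.preimage (mul_right_injective b).injOn)).subset fun g hg => ?_
    simp only [Set.mem_ofPred_eq, Set.mem_union, Set.mem_preimage, mul_assoc] at hg ⊢
    tauto
  | inv a _ ha =>
    refine (ha.preimage (mul_right_injective a⁻¹).injOn).subset fun g hg => ?_
    simp only [Set.mem_ofPred_eq, Set.mem_preimage, mul_inv_cancel_left] at hg ⊢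
    tauto

theorem coboundary_rightTranslate (g : G) :
    coboundary s (rightTranslate A g) = (fun e => (e.1, e.2 * g)) ⁻¹' coboundary s A := by
  ext e; simp [coboundary, rightTranslate, mul_assoc]

theorem mul_right_snd_bijective (g : G) :
    Function.Bijective (fun e : ι × G => (e.1, e.2 * g)) :=
  ((Equiv.refl ι).prodCongr (Equiv.mulRight g)).bijective

theorem ncard_coboundary_rightTranslate (g : G) :
    (coboundary s (rightTranslate A g)).ncard = (coboundary s A).ncard := by
  rw [coboundary_rightTranslate]
  exact Set.ncard_preimage_of_injective_subset_range (mul_right_snd_bijective g).1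
    (by simp [(mul_right_snd_bijective (ι := ι) g).2.range_eq])

theorem rightTranslate_infinite (h : A.Infinite) (g : G) : (rightTranslate A g).Infinite :=
  h.preimage (by simp [(Group.mulRight_bijective g).2.range_eq])

theorem IsCut.compl (h : IsCut s A) : IsCut s Aᶜ :=
  ⟨h.2, by rw [compl_compl]; exact h.1, by rw [coboundary_compl]; exact h.3⟩

theorem IsCut.nonempty (h : IsCut s A) : A.Nonempty := h.1.nonempty

theorem IsCut.compl_nonempty (h : IsCut s A) : Aᶜ.Nonempty := h.2.nonempty

theorem IsCut.rightTranslate (h : IsCut s A) (g : G) : IsCut s (rightTranslate A g) :=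
  ⟨rightTranslate_infinite h.1 g, rightTranslate_infinite h.2 g, by
    rw [coboundary_rightTranslate]
    exact h.3.preimage (mul_right_snd_bijective g).1.injOn⟩

theorem IsNarrow.compl (h : IsNarrow s A) : IsNarrow s Aᶜ :=
  ⟨h.1.compl, by rw [coboundary_compl]; exact h.2⟩

theorem IsNarrow.rightTranslate (h : IsNarrow s A) (g : G) : IsNarrow s (rightTranslate A g) :=
  ⟨h.1.rightTranslate g, by rw [ncard_coboundary_rightTranslate]; exact h.2⟩

theorem exists_isNarrow (h : IsCut s A) : ∃ B, IsNarrow s B := by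
  classical
  have hex : ∃ n, ∃ B, IsCut s B ∧ (coboundary s B).ncard = n := ⟨_, A, h, rfl⟩
  obtain ⟨B, hB, hn⟩ := Nat.find_spec hex
  exact ⟨B, hB, fun C hC => hn ▸ Nat.find_min' hex ⟨C, hC, rfl⟩⟩

/-- A narrow set is determined up to complement by any nonempty part of its coboundary that is
itself a coboundary. -/
theorem IsNarrow.eq_or_eq_compl (hs : Subgroup.closure (Set.range s) = ⊤) (hC : IsNarrow s C)
    (h0 : D ≠ ∅) (h1 : D ≠ Set.univ) (hD : coboundary s D ⊆ coboundary s C) :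
    D = C ∨ D = Cᶜ := by
  have hfin : (coboundary s D).Finite := hC.1.3.subset hD
  have hsd : coboundary s (symmDiff C D) = coboundary s C \ coboundary s D := by
    ext e
    have := @hD e
    rw [coboundary_symmDiff, Set.mem_symmDiff, Set.mem_sdiff]
    tauto
  have hne : (coboundary s D).Nonempty := by
    rw [Set.nonempty_iff_ne_empty]
    intro h
    rcases eq_empty_or_univ_of_coboundary_eq_empty hs h with h | h <;> contradiction
  have hlt : (coboundary s (symmDiff C D)).ncard < (coboundary s C).ncard := by
    rw [hsd]
    obtain ⟨e, he⟩ := hne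
    exact Set.ncard_lt_ncard ⟨Set.sdiff_subset, fun h => (h (hD he)).2 he⟩ hC.1.3
  have hsdfin : (coboundary s (symmDiff C D)).Finite := hsd ▸ hC.1.3.sdiff
  have hncut : ¬ IsCut s (symmDiff C D) := fun h => absurd (hC.2 _ h) (not_le.2 hlt)
  by_cases hDf : D.Finite
  · refine absurd ⟨fun h => hC.1.1 ?_, fun h => hC.1.2 ?_, hsdfin⟩ hncut
    · exact (h.union hDf).subset fun g hg => by
        by_cases hgD : g ∈ D
        · exact Or.inr hgD
        · exact Or.inl (Or.inl ⟨hg, hgD⟩)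
    · exact (h.union hDf).subset fun g hg => by
        by_cases hgD : g ∈ D
        · exact Or.inr hgD
        · refine Or.inl ?_
          rw [Set.mem_compl_iff, Set.mem_symmDiff]
          rw [Set.mem_compl_iff] at hg
          tauto
  by_cases hDc : Dᶜ.Finite
  · refine absurd ⟨fun h => hC.1.2 ?_, fun h => hC.1.1 ?_, hsdfin⟩ hncut
    · exact (h.union hDc).subset fun g hg => by
        by_cases hgD : g ∈ D
        · exact Or.inl (Or.inr ⟨hgD, hg⟩)
        · exact Or.inr hgD
    · exact (h.union hDc).subset fun g hg => by
        by_cases hgD : g ∈ D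
        · refine Or.inl ?_
          rw [Set.mem_compl_iff, Set.mem_symmDiff]
          tauto
        · exact Or.inr hgD
  have heq : coboundary s D = coboundary s C :=
    Set.eq_of_subset_of_ncard_le hD (hC.2 D ⟨hDf, hDc, hfin⟩) hC.1.3
  rw [heq, Set.sdiff_self] at hsd
  rcases eq_empty_or_univ_of_coboundary_eq_empty hs hsd with h | h
  · exact Or.inl (symmDiff_eq_bot.1 h).symm
  · refine Or.inr ?_
    ext g
    have : g ∈ symmDiff C D := h ▸ trivial
    rw [Set.mem_symmDiff] at this
    rw [Set.mem_compl_iff]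
    tauto

/-- Only finitely many narrow sets separate two given points. -/
theorem finite_isNarrow_separating (hs : Subgroup.closure (Set.range s) = ⊤) (p q : G) :
    {C | IsNarrow s C ∧ p ∈ C ∧ q ∉ C}.Finite := by
  by_contra hinf
  have := Set.Infinite.cofinite_inf_principal_neBot hinf
  set U : Ultrafilter (Set G) :=
    Ultrafilter.of (Filter.cofinite ⊓ Filter.principal {C | IsNarrow s C ∧ p ∈ C ∧ q ∉ C})
  have hU : ↑U ≤ Filter.cofinite ⊓ Filter.principal {C | IsNarrow s C ∧ p ∈ C ∧ q ∉ C} :=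
    Ultrafilter.of_le _
  have hmem : ∀ᶠ C in (U : Filter (Set G)), IsNarrow s C ∧ p ∈ C ∧ q ∉ C :=
    hU (Filter.mem_inf_of_right (Filter.mem_principal_self _))
  set L : Set G := {g | ∀ᶠ C in (U : Filter (Set G)), g ∈ C}
  have hL : ∀ g, ∀ᶠ C in (U : Filter (Set G)), (g ∈ C ↔ g ∈ L) := by
    intro g
    by_cases hg : g ∈ L
    · filter_upwards [show ∀ᶠ C in (U : Filter (Set G)), g ∈ C from hg] with C hC
      simp [hC, hg]
    · filter_upwards [Ultrafilter.eventually_not.2 hg] with C hC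
      simp [hC, hg]
  have hne : ∀ᶠ C in (U : Filter (Set G)), C ≠ L :=
    hU (Filter.mem_inf_of_left (Set.finite_singleton L).compl_mem_cofinite)
  have hcob : ∀ F : Set (ι × G), F.Finite → F ⊆ coboundary s L →
      ∀ᶠ C in (U : Filter (Set G)), F ⊆ coboundary s C := by
    intro F hF hFL
    have : ∀ᶠ C in (U : Filter (Set G)), ∀ e ∈ F, e ∈ coboundary s C := by
      refine (Filter.eventually_all_finite hF).2 fun e he => ?_
      filter_upwards [hL e.2, hL (s e.1 * e.2)] with C h1 h2
      have := hFL he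
      simp only [coboundary, Set.mem_ofPred_eq] at this ⊢
      rwa [h1, h2]
    exact this
  have hfin : (coboundary s L).Finite := by
    by_contra h
    obtain ⟨C₀, hC₀⟩ := hmem.exists
    obtain ⟨F, hFL, hF, hcard⟩ :=
      Set.Infinite.exists_subset_ncard_eq h ((coboundary s C₀).ncard + 1)
    obtain ⟨C, hC, hFC⟩ := (hmem.and (hcob F hF hFL)).exists
    have h1 := Set.ncard_le_ncard hFC hC.1.1.3
    have h2 := hC.1.2 _ hC₀.1.1
    omega
  obtain ⟨C, ⟨⟨⟨hC, hpC, hqC⟩, hCL⟩, hsub⟩, hpL, hqL⟩ :=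
    (((hmem.and hne).and (hcob _ hfin subset_rfl)).and ((hL p).and (hL q))).exists
  have hp : p ∈ L := hpL.1 hpC
  have hq : q ∉ L := fun h => hqC (hqL.2 h)
  rcases hC.eq_or_eq_compl hs (Set.nonempty_iff_ne_empty.1 ⟨p, hp⟩)
    (fun h => hq (h ▸ trivial)) hsub with h | h
  · exact hCL h.symm
  · exact (h ▸ hp : p ∈ Cᶜ) hpC

end Coboundary

section Crosses

variable {X : Type*} {A B C : Set X}

theorem Crosses.symm (h : Crosses A B) : Crosses B A := by
  obtain ⟨h1, h2, h3, h4⟩ := h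
  refine ⟨?_, ?_, ?_, ?_⟩ <;> rw [Set.inter_comm] <;> assumption

theorem crosses_compl_left : Crosses Aᶜ B ↔ Crosses A B := by
  simp only [Crosses, compl_compl]; tauto

theorem crosses_compl_right : Crosses A Bᶜ ↔ Crosses A B := by
  simp only [Crosses, compl_compl]; tauto

theorem Crosses.of_inter_or_union (hAB : Crosses A B)
    (h : Crosses (A ∩ B) C ∨ Crosses (A ∪ B) C) : Crosses A C ∨ Crosses B C := by
  simp only [Crosses, Set.Nonempty, Set.mem_inter_iff, Set.mem_union, Set.mem_compl_iff] at *
  grind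

theorem Crosses.of_inter_and_union (h : Crosses (A ∩ B) C) (h' : Crosses (A ∪ B) C) :
    Crosses A C ∧ Crosses B C := by
  simp only [Crosses, Set.Nonempty, Set.mem_inter_iff, Set.mem_union, Set.mem_compl_iff] at *
  grind

end Crosses

section Crossing

variable {G ι : Type*} [Group G] {s : ι → G} {A B C D : Set G}

theorem Crosses.rightTranslate (h : Crosses A B) (g : G) :
    Crosses (rightTranslate A g) (rightTranslate B g) := by
  obtain ⟨⟨a, ha⟩, ⟨b, hb⟩, ⟨c, hc⟩, ⟨d, hd⟩⟩ := h
  refine ⟨⟨a * g⁻¹, ?_⟩, ⟨b * g⁻¹, ?_⟩, ⟨c * g⁻¹, ?_⟩, ⟨d * g⁻¹, ?_⟩⟩ <;>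
  simpa [_root_.rightTranslate]

@[simp] theorem rightTranslate_one : rightTranslate A 1 = A := by simp [rightTranslate]

theorem rightTranslate_rightTranslate (g h : G) :
    rightTranslate (rightTranslate A g) h = rightTranslate A (h * g) := by
  simp [rightTranslate, mul_assoc]

/-- A narrow set is connected, so whatever crosses it has a coboundary edge inside it. -/
theorem IsNarrow.exists_mem_coboundary (hs : Subgroup.closure (Set.range s) = ⊤)
    (hC : IsNarrow s C) (h : Crosses A C) : ∃ e ∈ coboundary s A, e.2 ∈ C := by
  by_contra! hcon
  have hsub : coboundary s (C ∩ A) ⊆ coboundary s C := by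
    intro e he
    have := hcon e
    simp only [coboundary, Set.mem_ofPred_eq, Set.mem_inter_iff] at he this ⊢
    tauto
  obtain ⟨⟨a, ha, haC⟩, -, ⟨c, hc, hc'⟩, -⟩ := h
  have ha₀ : a ∈ C ∩ A := ⟨haC, ha⟩
  have hc₀ : c ∉ C ∩ A := fun h => hc h.2
  rcases hC.eq_or_eq_compl hs (Set.nonempty_iff_ne_empty.1 ⟨a, ha₀⟩)
    (fun h => hc₀ (h ▸ Set.mem_univ c)) hsub with h | h
  · exact hc₀ (h.symm ▸ hc')
  · rw [h] at ha₀
    exact ha₀ haC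

/-- The narrow sets crossing a given set. -/
def narrowCrossing (s : ι → G) (A : Set G) : Set (Set G) := {C | IsNarrow s C ∧ Crosses A C}

theorem finite_narrowCrossing (hs : Subgroup.closure (Set.range s) = ⊤)
    (hA : (coboundary s A).Finite) : (narrowCrossing s A).Finite := by
  refine (hA.biUnion fun e _ => hA.biUnion fun e' _ =>
    finite_isNarrow_separating hs e.2 e'.2).subset ?_
  rintro C ⟨hC, hAC⟩
  obtain ⟨e, he, heC⟩ := hC.exists_mem_coboundary hs hAC
  obtain ⟨e', he', heC'⟩ := hC.compl.exists_mem_coboundary hs (crosses_compl_right.2 hAC)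
  simp only [Set.mem_iUnion]
  exact ⟨e, he, e', he', hC, heC, heC'⟩

theorem narrowCrossing_compl : narrowCrossing s Aᶜ = narrowCrossing s A := by
  simp only [narrowCrossing, crosses_compl_left]

theorem ncard_narrowCrossing_rightTranslate_le (hs : Subgroup.closure (Set.range s) = ⊤)
    (hA : (coboundary s A).Finite) (g : G) :
    (narrowCrossing s (rightTranslate A g)).ncard ≤ (narrowCrossing s A).ncard := by
  have hfin := finite_narrowCrossing hs hA
  refine (Set.ncard_le_ncard ?_ (hfin.image fun C => rightTranslate C g)).trans
    (Set.ncard_image_le hfin)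
  rintro C ⟨hC, hAC⟩
  refine ⟨rightTranslate C g⁻¹, ⟨hC.rightTranslate _, ?_⟩, ?_⟩
  · simpa [rightTranslate_rightTranslate] using hAC.rightTranslate g⁻¹
  · simp [rightTranslate_rightTranslate]

theorem IsNarrow.inter_union (hA : IsNarrow s A) (hB : IsNarrow s B) (h1 : (A ∩ B).Infinite)
    (h2 : (A ∪ B)ᶜ.Infinite) : IsNarrow s (A ∩ B) ∧ IsNarrow s (A ∪ B) := by
  have hfin := hA.1.3.union hB.1.3
  have hsub := coboundary_inter_union_subset (s := s) (A := A) (B := B)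
  have hI : IsCut s (A ∩ B) := ⟨h1, hA.1.2.mono (Set.compl_subset_compl.2 Set.inter_subset_left),
    hfin.subset (Set.subset_union_left.trans hsub)⟩
  have hU : IsCut s (A ∪ B) := ⟨hA.1.1.mono Set.subset_union_left, h2,
    hfin.subset (Set.subset_union_right.trans hsub)⟩
  have e1 := Set.ncard_union_add_ncard_inter _ _ hI.3 hU.3
  have e2 := Set.ncard_union_add_ncard_inter _ _ hA.1.3 hB.1.3
  have l1 := Set.ncard_le_ncard hsub hfin
  have l2 := Set.ncard_le_ncard (coboundary_inter_inter_subset (s := s) (A := A) (B := B))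
    (hA.1.3.inter_of_left _)
  have m1 := hA.2 _ hI
  have m2 := hB.2 _ hU
  exact ⟨⟨hI, fun D hD => by have := hA.2 D hD; have := hB.2 D hD; omega⟩,
    ⟨hU, fun D hD => by have := hA.2 D hD; have := hB.2 D hD; omega⟩⟩

theorem ncard_narrowCrossing_inter_add_union_lt (hs : Subgroup.closure (Set.range s) = ⊤)
    (hA : IsNarrow s A) (hB : IsNarrow s B) (hAB : Crosses A B) (h1 : (A ∩ B).Infinite)
    (h2 : (A ∪ B)ᶜ.Infinite) :
    (narrowCrossing s (A ∩ B)).ncard + (narrowCrossing s (A ∪ B)).ncard <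
      (narrowCrossing s A).ncard + (narrowCrossing s B).ncard := by
  obtain ⟨hI, hU⟩ := hA.inter_union hB h1 h2
  have fA := finite_narrowCrossing hs hA.1.3
  have fB := finite_narrowCrossing hs hB.1.3
  have fI := finite_narrowCrossing hs hI.1.3
  have fU := finite_narrowCrossing hs hU.1.3
  have e1 := Set.ncard_union_add_ncard_inter _ _ fI fU
  have e2 := Set.ncard_union_add_ncard_inter _ _ fA fB
  have l1 : (narrowCrossing s (A ∩ B) ∪ narrowCrossing s (A ∪ B)).ncard <
      (narrowCrossing s A ∪ narrowCrossing s B).ncard := by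
    refine Set.ncard_lt_ncard ⟨?_, fun h => ?_⟩ (fA.union fB)
    · rintro C (⟨hC, h⟩ | ⟨hC, h⟩)
      · exact (hAB.of_inter_or_union (Or.inl h)).imp (fun h => ⟨hC, h⟩) fun h => ⟨hC, h⟩
      · exact (hAB.of_inter_or_union (Or.inr h)).imp (fun h => ⟨hC, h⟩) fun h => ⟨hC, h⟩
    · rcases h (Or.inr ⟨hA, hAB.symm⟩) with h | h
      · obtain ⟨a, ha, ha'⟩ := h.2.2.1
        exact ha' ha.1
      · obtain ⟨a, ha, ha'⟩ := h.2.2.2.1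
        exact ha (Or.inl ha')
  have l2 : (narrowCrossing s (A ∩ B) ∩ narrowCrossing s (A ∪ B)).ncard ≤
      (narrowCrossing s A ∩ narrowCrossing s B).ncard := by
    refine Set.ncard_le_ncard ?_ (fA.inter_of_left _)
    rintro C ⟨⟨hC, h⟩, ⟨-, h'⟩⟩
    exact ⟨⟨hC, (h.of_inter_and_union h').1⟩, ⟨hC, (h.of_inter_and_union h').2⟩⟩
  omega

/-- There is a cut none of whose translates cross it. -/
theorem exists_isCut_not_crosses (hs : Subgroup.closure (Set.range s) = ⊤) (hA : IsCut s A) :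
    ∃ S, IsCut s S ∧ ∀ g, ¬ Crosses S (rightTranslate S g) := by
  classical
  obtain ⟨B, hB⟩ := exists_isNarrow hA
  have hex : ∃ n, ∃ S, IsNarrow s S ∧ (narrowCrossing s S).ncard = n := ⟨_, B, hB, rfl⟩
  obtain ⟨S, hS, hn⟩ := Nat.find_spec hex
  have hmin : ∀ C, IsNarrow s C → (narrowCrossing s S).ncard ≤ (narrowCrossing s C).ncard :=
    fun C hC => hn ▸ Nat.find_min' hex ⟨C, hC, rfl⟩
  have key : ∀ C, IsNarrow s C → (narrowCrossing s C).ncard ≤ (narrowCrossing s S).ncard →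
      Crosses S C → (S ∩ C).Infinite → (S ∪ C)ᶜ.Infinite → False := by
    intro C hC hle hSC h1 h2
    obtain ⟨hI, hU⟩ := hS.inter_union hC h1 h2
    have := ncard_narrowCrossing_inter_add_union_lt hs hS hC hSC h1 h2
    have := hmin _ hI
    have := hmin _ hU
    omega
  refine ⟨S, hS.1, fun g hcr => ?_⟩
  set C := rightTranslate S g
  have hC : IsNarrow s C := hS.rightTranslate g
  have hle := ncard_narrowCrossing_rightTranslate_le hs hS.1.3 g
  have inf : ∀ X Y : Set G, X.Infinite → (X ∩ Y).Finite → (X ∩ Yᶜ).Infinite := by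
    intro X Y hX hXY h
    exact hX (by rw [← Set.inter_union_compl X Y]; exact hXY.union h)
  by_cases h1 : (S ∩ C).Finite
  · refine key Cᶜ hC.compl (by rwa [narrowCrossing_compl]) (crosses_compl_right.2 hcr)
      (inf _ _ hS.1.1 h1) ?_
    rw [Set.compl_union, compl_compl, Set.inter_comm]
    exact inf _ _ hC.1.1 (by rwa [Set.inter_comm])
  · by_cases h2 : (S ∪ C)ᶜ.Finite
    · rw [Set.compl_union] at h2
      refine key Cᶜ hC.compl (by rwa [narrowCrossing_compl]) (crosses_compl_right.2 hcr) ?_ ?_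
      · rw [Set.inter_comm]
        simpa using inf Cᶜ Sᶜ hC.1.2 (by rwa [Set.inter_comm])
      · rw [Set.compl_union]
        exact inf Sᶜ Cᶜ hS.1.2 h2
    · exact key C hC hle hcr h1 h2

end Crossing

/-- A left-ordered group with finite intervals is cyclic. -/
theorem exists_forall_mem_zpowers_of_finite_Ioc {G : Type*} [Group G] [LinearOrder G]
    [MulLeftStrictMono G] (hfin : ∀ g : G, (Set.Ioc 1 g).Finite) :
    ∃ t : G, ∀ g, g ∈ Subgroup.zpowers t := by
  by_cases hpos : ∃ g : G, 1 < g
  · obtain ⟨g₀, hg₀⟩ := hpos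
    obtain ⟨t, ht, hmin⟩ := (hfin g₀).exists_minimal ⟨g₀, hg₀, le_rfl⟩
    have hle : ∀ g, 1 < g → t ≤ g := by
      intro g hg
      rcases le_total t g with h | h
      · exact h
      · exact hmin ⟨hg, h.trans ht.2⟩ h
    have key : ∀ n : ℕ, ∀ g : G, 1 < g → (Set.Ioc 1 g).ncard = n → g ∈ Subgroup.zpowers t := by
      intro n
      induction n using Nat.strong_induction_on with
      | _ n ih =>
        rintro g hg rfl
        rcases (hle g hg).eq_or_lt with rfl | htg
        · exact Subgroup.mem_zpowers _
        · have h1 : 1 < t⁻¹ * g := by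
            simpa using mul_lt_mul_right htg t⁻¹
          have hlt : (Set.Ioc 1 (t⁻¹ * g)).ncard < (Set.Ioc 1 g).ncard := by
            rw [← Set.ncard_image_of_injective _ (mul_right_injective t)]
            refine Set.ncard_lt_ncard ⟨?_, fun h => ?_⟩ (hfin g)
            · rintro _ ⟨k, ⟨hk1, hk2⟩, rfl⟩
              have h3 : t * 1 < t * k := mul_lt_mul_right hk1 t
              rw [mul_one] at h3
              refine ⟨ht.1.trans h3, ?_⟩
              rcases hk2.eq_or_lt with rfl | hk2
              · simp
              · simpa using (mul_lt_mul_right hk2 t).le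
            · obtain ⟨k, hk, hkt⟩ := h ⟨ht.1, htg.le⟩
              exact hk.1.ne' (by simpa using hkt)
          have := ih _ hlt _ h1 rfl
          simpa using mul_mem (Subgroup.mem_zpowers t) this
    refine ⟨t, fun g => ?_⟩
    rcases lt_trichotomy g 1 with h | rfl | h
    · have : 1 < g⁻¹ := by simpa using mul_lt_mul_right h g⁻¹
      exact inv_mem_iff.1 (key _ _ this rfl)
    · exact one_mem _
    · exact key _ _ h rfl
  · push Not at hpos
    refine ⟨1, fun g => ?_⟩
    have h1 := hpos g
    have h2 := hpos g⁻¹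
    rcases h1.eq_or_lt with rfl | h
    · exact one_mem _
    · have : 1 < g⁻¹ := by simpa using mul_lt_mul_right h g⁻¹
      exact absurd h2 (not_le.2 this)

theorem exists_forall_ge_le_iff_of_finite {p : ℤ → Prop} (h : {n | ¬ (p n ↔ p (n + 1))}.Finite) :
    ∃ N : ℤ, 0 ≤ N ∧ ∀ n, N ≤ n → (p n ↔ p N) ∧ (p (-n) ↔ p (-N)) := by
  obtain ⟨a, ha⟩ := h.bddAbove
  obtain ⟨b, hb⟩ := h.bddBelow
  refine ⟨max 0 (max (a + 1) (-b + 1)), le_max_left _ _, fun n hn => ?_⟩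
  induction n, hn using Int.leInduction with
  | base => simp
  | succ n hn ih =>
    have h1 : p n ↔ p (n + 1) := by
      by_contra hc
      have := ha hc
      omega
    have h2 : p (-(n + 1)) ↔ p (-(n + 1) + 1) := by
      by_contra hc
      have := hb hc
      omega
    rw [show -(n + 1) + 1 = -n by ring] at h2
    exact ⟨h1.symm.trans ih.1, h2.trans ih.2⟩

section Axis

variable {G ι : Type*} [Group G] {s : ι → G} {S : Set G}

/-- If no proper nonempty almost invariant set is `h`-invariant, then every cut separates the two
ends of some `h`-orbit. -/
theorem IsCut.exists_separates [Finite ι] (hs : Subgroup.closure (Set.range s) = ⊤)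
    (hS : IsCut s S) {h : G} (hord : Function.Injective fun n : ℤ => h ^ n)
    (hinv : ∀ A : Set G, (coboundary s A).Finite → (∀ g, g ∈ A ↔ h * g ∈ A) →
      A = ∅ ∨ A = Set.univ) :
    ∃ g, ∃ N : ℤ, (∀ n, N ≤ n → h ^ n * g ∈ S ∧ h ^ (-n) * g ∉ S) ∨
      (∀ n, N ≤ n → h ^ n * g ∉ S ∧ h ^ (-n) * g ∈ S) := by
  by_contra! hcon
  set B := {w | ¬ (w ∈ S ↔ h * w ∈ S)}
  have hB : B.Finite := finite_mul_mem_xor hs hS.3 h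
  have hinj : ∀ g, Function.Injective fun n : ℤ => h ^ n * g :=
    fun g => (mul_left_injective g).comp hord
  have hev : ∀ g, ∃ N : ℤ, 0 ≤ N ∧ ∀ n, N ≤ n → (h ^ n * g ∈ S ↔ h ^ N * g ∈ S) ∧
      (h ^ (-n) * g ∈ S ↔ h ^ (-N) * g ∈ S) := by
    intro g
    refine exists_forall_ge_le_iff_of_finite (p := fun n => h ^ n * g ∈ S) ?_
    refine (hB.preimage (hinj g).injOn).subset fun n hn => ?_
    simp only [B, Set.mem_preimage, Set.mem_ofPred_eq, ← mul_assoc, ← zpow_one_add] at hn ⊢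
    rwa [add_comm]
  set A : Set G := {g | ∃ N : ℤ, ∀ n, N ≤ n → h ^ n * g ∈ S}
  have hA : ∀ g, g ∈ A ↔ h * g ∈ A := by
    intro g
    constructor
    · rintro ⟨N, hN⟩
      refine ⟨N, fun n hn => ?_⟩
      rw [← mul_assoc, ← zpow_add_one]
      exact hN _ (by omega)
    · rintro ⟨N, hN⟩
      refine ⟨N + 1, fun n hn => ?_⟩
      have := hN (n - 1) (by omega)
      rwa [← mul_assoc, ← zpow_add_one, sub_add_cancel] at this
  have hseg : ∀ b b' : G,
      {g | ∃ n m : ℤ, 0 ≤ n ∧ m ≤ 0 ∧ h ^ n * g = b ∧ h ^ m * g = b'}.Finite := by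
    intro b b'
    by_cases hne : ∃ k : ℤ, b = h ^ k * b'
    · obtain ⟨k, hk⟩ := hne
      refine ((Set.finite_Icc 0 k).image fun n => h ^ (-n) * b).subset ?_
      rintro g ⟨n, m, hn, hm, h1, h2⟩
      have : n - m = k := by
        apply hinj b'
        simp only
        rw [← hk, ← h1, ← h2, ← mul_assoc, ← zpow_add, sub_add_cancel]
      refine ⟨n, ⟨hn, by omega⟩, ?_⟩
      simp [← h1]
    · refine Set.finite_empty.subset ?_
      rintro g ⟨n, m, hn, hm, h1, h2⟩
      refine hne ⟨n - m, ?_⟩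
      rw [← h1, ← h2, ← mul_assoc, ← zpow_add, sub_add_cancel]
  have hsd : (symmDiff S A).Finite := by
    refine (hB.biUnion fun b _ => hB.biUnion fun b' _ => hseg b b').subset fun g hg => ?_
    obtain ⟨N, hN0, hN⟩ := hev g
    have hAN : g ∈ A ↔ h ^ N * g ∈ S := by
      constructor
      · rintro ⟨M, hM⟩
        exact (hN (max M N) (le_max_right _ _)).1.1 (hM _ (le_max_left _ _))
      · exact fun h => ⟨N, fun n hn => (hN n hn).1.2 h⟩
    have hNN : h ^ N * g ∈ S ↔ h ^ (-N) * g ∈ S := by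
      have hc := hcon g N
      by_contra hne
      by_cases h1 : h ^ N * g ∈ S
      · obtain ⟨n, hn, hn'⟩ := hc.1
        have := hN n hn
        tauto
      · obtain ⟨n, hn, hn'⟩ := hc.2
        have := hN n hn
        tauto
    have hgS : ¬ (g ∈ S ↔ h ^ N * g ∈ S) := by
      rw [Set.mem_symmDiff] at hg
      tauto
    have step : ∀ a b : ℤ, a ≤ b → ¬ (h ^ a * g ∈ S ↔ h ^ b * g ∈ S) →
        ∃ n, a ≤ n ∧ n < b ∧ h ^ n * g ∈ B := by
      intro a b hab
      induction b, hab using Int.leInduction with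
      | base => simp
      | succ b hab ih =>
        intro hne
        by_cases hb : h ^ a * g ∈ S ↔ h ^ b * g ∈ S
        · refine ⟨b, hab, by omega, ?_⟩
          simp only [B, Set.mem_ofPred_eq]
          rw [← mul_assoc, ← zpow_one_add, add_comm 1 b]
          tauto
        · obtain ⟨n, h1, h2, h3⟩ := ih hb
          exact ⟨n, h1, by omega, h3⟩
    obtain ⟨n, hn, -, hnB⟩ := step 0 N hN0 (by simpa using hgS)
    obtain ⟨m, -, hm, hmB⟩ := step (-N) 0 (by omega) (by simp only [zpow_zero, one_mul]; tauto)
    simp only [Set.mem_iUnion]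
    exact ⟨_, hnB, _, hmB, n, m, hn, hm.le, rfl, rfl⟩
  rcases hinv A (finite_coboundary_of_symmDiff hS.3 hsd) hA with h0 | h0
  · exact hS.1 (hsd.subset fun g hg => Or.inl ⟨hg, by simp [h0]⟩)
  · exact hS.2 (hsd.subset fun g hg => Or.inr ⟨by simp [h0], hg⟩)

/-- Under the noncrossing hypothesis, the translates of a cut along `h` form a strictly
increasing exhausting chain. -/
theorem exists_axis [Finite ι] (hs : Subgroup.closure (Set.range s) = ⊤)
    (hS : IsCut s S) (hcr : ∀ g, ¬ Crosses S (rightTranslate S g)) {h : G}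
    (hord : Function.Injective fun n : ℤ => h ^ n)
    (hinv : ∀ A : Set G, (coboundary s A).Finite → (∀ g, g ∈ A ↔ h * g ∈ A) →
      A = ∅ ∨ A = Set.univ) :
    ∃ g R, (R = rightTranslate S g ∨ R = (rightTranslate S g)ᶜ) ∧
      (∀ k, ∀ m n : ℤ, m ≤ n → k * h ^ m ∈ R → k * h ^ n ∈ R) ∧
      (∀ p, ∃ m : ℤ, p * h ^ m ∈ R) ∧ ∀ p, ∃ m : ℤ, p * h ^ m ∉ R := by
  obtain ⟨g, R, hR, N, hN⟩ : ∃ g R, (R = rightTranslate S g ∨ R = (rightTranslate S g)ᶜ) ∧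
      ∃ N : ℤ, ∀ n, N ≤ n → h ^ n ∈ R ∧ h ^ (-n) ∉ R := by
    obtain ⟨g, N, hN | hN⟩ := hS.exists_separates hs hord hinv
    · exact ⟨g, _, Or.inl rfl, N, hN⟩
    · exact ⟨g, _, Or.inr rfl, N, fun n hn => ⟨(hN n hn).1, not_not.2 (hN n hn).2⟩⟩
  have hRcut : IsCut s R := by
    rcases hR with rfl | rfl
    · exact hS.rightTranslate g
    · exact (hS.rightTranslate g).compl
  have hRcr : ¬ Crosses R (rightTranslate R h) := by
    have : ¬ Crosses (rightTranslate S g) (rightTranslate (rightTranslate S g) h) := by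
      intro hc
      have := hc.rightTranslate g⁻¹
      simp only [rightTranslate_rightTranslate] at this
      exact hcr _ (by simpa using this)
    rcases hR with rfl | rfl
    · exact this
    · exact fun hc => this (crosses_compl_left.1 (crosses_compl_right.1 hc))
  have hstep : ∀ k, k ∈ R → k * h ∈ R := by
    by_contra! hne
    obtain ⟨k, hk, hkh⟩ := hne
    have hback : ∀ k, k * h ∈ R → k ∈ R := by
      by_contra! hne
      obtain ⟨l, hl, hl'⟩ := hne
      refine hRcr ⟨⟨h ^ N, (hN N le_rfl).1, ?_⟩, ⟨k, hk, hkh⟩, ⟨l, hl', hl⟩,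
        ⟨h ^ (-(N + 1)), (hN _ (by omega)).2, ?_⟩⟩
      · simp only [rightTranslate, Set.mem_ofPred_eq]
        rw [← zpow_add_one]
        exact (hN _ (by omega)).1
      · simp only [rightTranslate, Set.mem_compl_iff, Set.mem_ofPred_eq]
        rw [← zpow_add_one]
        simpa using (hN _ le_rfl).2
    have : ∀ n : ℤ, n ≤ |N| → h ^ n ∈ R := by
      intro n hn
      induction n, hn using Int.leInductionDown with
      | base => exact (hN _ (le_abs_self N)).1
      | pred n hn ih => exact hback _ (by rwa [← zpow_add_one, sub_add_cancel])
    exact (hN _ (le_abs_self N)).2 (this _ (by have := abs_nonneg N; omega))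
  have hfar : ∀ (p : G) (ε : ℤ), ε ≠ 0 →
      ∃ n : ℤ, N ≤ n ∧ (h ^ (ε * n) ∈ R ↔ p * h ^ (ε * n) ∈ R) := by
    intro p ε hε
    by_contra! hne
    refine (Set.Ici_infinite N) (((finite_mul_mem_xor hs hRcut.3 p).preimage
      (f := fun n : ℤ => h ^ (ε * n)) ?_).subset fun n hn => ?_)
    · exact (hord.comp (mul_right_injective₀ hε)).injOn
    · have := hne n hn
      simp only [Set.mem_preimage, Set.mem_ofPred_eq]
      tauto
  refine ⟨g, R, hR, fun k m n hmn hm => ?_, fun p => ?_, fun p => ?_⟩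
  · induction n, hmn using Int.leInduction with
    | base => exact hm
    | succ n _ ih => rw [zpow_add_one, ← mul_assoc]; exact hstep _ ih
  · obtain ⟨n, hn, h1⟩ := hfar p 1 one_ne_zero
    exact ⟨_, h1.1 (by simpa using (hN n hn).1)⟩
  · obtain ⟨n, hn, h1⟩ := hfar p (-1) (by simp)
    exact ⟨_, fun h2 => (hN n hn).2 (by simpa using h1.2 h2)⟩

end Axis

/-- The translates of `S` nested between `S` and a translate disjoint from `S`, recorded by the
translating elements. -/
def nestedBetween {G : Type*} [Group G] (S : Set G) (h : G) : Set G :=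
  {w | ((∀ k ∈ S, k * w ∈ S) ∧ ∀ k, k * w ∈ S → k * h ∉ S) ∨
    ((∀ k ∈ S, k * w ∉ S) ∧ ∀ k, k * h ∈ S → k * w ∈ S)}

section Noncrossing

variable {G ι : Type*} [Group G] {s : ι → G} {S : Set G}

theorem finite_mul_mem_and_mul_notMem (hs : Subgroup.closure (Set.range s) = ⊤)
    (hS : (coboundary s S).Finite) (p q : G) : {w | p * w ∈ S ∧ q * w ∉ S}.Finite := by
  refine ((finite_mul_mem_xor hs hS (q * p⁻¹)).preimage (mul_right_injective p).injOn).subset ?_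
  rintro w ⟨h1, h2⟩
  simp only [Set.mem_preimage, Set.mem_ofPred_eq, mul_assoc, inv_mul_cancel_left]
  tauto

theorem finite_nestedBetween (hs : Subgroup.closure (Set.range s) = ⊤) (hS : IsCut s S) (h : G) :
    (nestedBetween S h).Finite := by
  obtain ⟨p, hp⟩ := hS.nonempty
  have hq : p * h⁻¹ * h ∈ S := by simpa
  refine ((finite_mul_mem_and_mul_notMem hs hS.3 p (p * h⁻¹)).union
    (finite_mul_mem_and_mul_notMem hs hS.3 (p * h⁻¹) p)).subset ?_
  rintro w (⟨h1, h2⟩ | ⟨h1, h2⟩)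
  · exact Or.inl ⟨h1 p hp, fun h3 => h2 _ h3 hq⟩
  · exact Or.inr ⟨h2 _ hq, h1 p hp⟩

/-- Translates of a noncrossing cut are never disjoint from it. -/
theorem exists_mem_inter_rightTranslate [Finite ι] (hs : Subgroup.closure (Set.range s) = ⊤)
    (hS : IsCut s S) (hcr : ∀ g, ¬ Crosses S (rightTranslate S g))
    (hord : ∀ h : G, h ≠ 1 → Function.Injective fun n : ℤ => h ^ n)
    (hinv : ∀ h : G, h ≠ 1 → ∀ A : Set G, (coboundary s A).Finite →
      (∀ g, g ∈ A ↔ h * g ∈ A) → A = ∅ ∨ A = Set.univ) (h : G) :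
    ∃ k ∈ S, k * h ∈ S := by
  by_contra! hdis
  induction hn : (nestedBetween S h).ncard using Nat.strong_induction_on generalizing h with
  | _ n ih =>
  subst hn
  have hne : h ≠ 1 := by
    rintro rfl
    obtain ⟨p, hp⟩ := hS.nonempty
    exact hdis p hp (by simpa)
  obtain ⟨g', R, hR, hmono, hin, hout⟩ := exists_axis hs hS hcr (hord h hne) (hinv h hne)
  have hadd : ∀ (k : G) (m : ℤ), k * h ^ (m + 1) = k * h * h ^ m := fun k m => by
    rw [mul_assoc, ← zpow_one_add, add_comm]
  have hmono' : ∀ (k : G) (m : ℤ), k * h ^ m ∈ R → k * h ^ (m + 1) ∈ R :=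
    fun k m => hmono k m _ (by omega)
  have ex1 : ∀ m : ℤ, ∃ k, k * h ^ m ∈ R ∧ k ∉ S := by
    by_contra! hc
    obtain ⟨m, hm⟩ := hc
    obtain ⟨k, hk⟩ : ∃ k, k * h ^ m ∈ R := by
      obtain ⟨n, hn⟩ := hin 1
      exact ⟨h ^ n * (h ^ m)⁻¹, by simpa using hn⟩
    exact hdis k (hm k hk) (hm _ (by rw [← hadd]; exact hmono' _ _ hk))
  have ex2 : ∀ m : ℤ, ∃ k, k * h ^ m ∉ R ∧ k ∉ S := by
    by_contra! hc
    obtain ⟨m, hm⟩ := hc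
    obtain ⟨k, hk⟩ : ∃ k, k * h ^ (m + 1) ∉ R := by
      obtain ⟨n, hn⟩ := hout 1
      exact ⟨h ^ n * (h ^ (m + 1))⁻¹, by simpa using hn⟩
    exact hdis k (hm k fun h1 => hk (hmono' _ _ h1)) (hm _ (by rwa [← hadd]))
  have hRm : ∀ m : ℤ, ∃ g, (∀ k, k * h ^ m ∈ R ↔ k * g ∈ S) ∨ ∀ k, k * h ^ m ∈ R ↔ k * g ∉ S := by
    intro m
    refine ⟨h ^ m * g', ?_⟩
    rcases hR with rfl | rfl
    · left; intro k; simp [rightTranslate, mul_assoc]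
    · right; intro k; simp [rightTranslate, mul_assoc]
  have hnest : ∀ m : ℤ, (∀ k ∈ S, k * h ^ m ∈ R) ∨ ∀ k ∈ S, k * h ^ m ∉ R := by
    intro m
    by_contra! hc
    obtain ⟨⟨a, ha, ha'⟩, b, hb, hb'⟩ := hc
    obtain ⟨c, hc, hc'⟩ := ex1 m
    obtain ⟨d, hd, hd'⟩ := ex2 m
    obtain ⟨g, hg | hg⟩ := hRm m
    · rw [hg] at ha' hb' hc hd
      exact hcr g ⟨⟨b, hb, hb'⟩, ⟨a, ha, ha'⟩, ⟨c, hc', hc⟩, ⟨d, hd', hd⟩⟩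
    · rw [hg] at ha' hb' hc hd
      exact hcr g ⟨⟨a, ha, not_not.1 ha'⟩, ⟨b, hb, hb'⟩, ⟨d, hd', not_not.1 hd⟩, ⟨c, hc', hc⟩⟩
  obtain ⟨m, hm, hm'⟩ : ∃ m : ℤ, (∀ k ∈ S, k * h ^ (m + 1) ∈ R) ∧ ∀ k ∈ S, k * h ^ m ∉ R := by
    by_contra! hc
    obtain ⟨p, hp⟩ := hS.nonempty
    obtain ⟨a, ha⟩ := hin p
    obtain ⟨b, hb⟩ := hout p
    have haS : ∀ k ∈ S, k * h ^ a ∈ R := (hnest a).resolve_right fun h => h p hp ha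
    have : ∀ n : ℤ, n ≤ a → ∀ k ∈ S, k * h ^ n ∈ R := by
      intro n hn
      induction n, hn using Int.leInductionDown with
      | base => exact haS
      | pred n hn ih =>
        have := hc (n - 1) (by simpa using ih)
        obtain ⟨k, hk, hkR⟩ := this
        exact (hnest (n - 1)).resolve_right fun h => h k hk hkR
    rcases le_total a b with hab | hab
    · exact hb (hmono _ _ _ hab ha)
    · exact hb (this b hab p hp)
  have hRh : ∀ k, k * h ^ (m + 1) ∈ R → k * h ∉ S := by
    intro k hk hkh
    rw [hadd] at hk
    exact hm' _ hkh hk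
  obtain ⟨g, hg | hg⟩ := hRm (m + 1)
  · simp only [hg] at hm hRh
    have hg' : ∀ k, k * (g⁻¹ * h) ∈ S → k ∉ S := by
      intro k hk hkS
      refine hRh (k * g⁻¹) (by simpa) (by simpa [mul_assoc] using hk)
    refine ih _ ?_ (g⁻¹ * h) (fun k hk hk' => hg' k hk' hk) rfl
    rw [← Set.ncard_image_of_injective _ (mul_right_injective g)]
    refine Set.ncard_lt_ncard ⟨?_, fun hsub => ?_⟩ (finite_nestedBetween hs hS h)
    · rintro _ ⟨w, ⟨h1, h2⟩ | ⟨h1, h2⟩, rfl⟩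
      · refine Or.inl ⟨fun k hk => ?_, fun k hk hkh => ?_⟩
        · simpa [mul_assoc] using h1 _ (hm k hk)
        · exact h2 (k * g) (by simpa [mul_assoc] using hk) (by simpa [mul_assoc] using hkh)
      · refine Or.inr ⟨fun k hk hk' => ?_, fun k hk => ?_⟩
        · exact h1 _ (hm k hk) (by simpa [mul_assoc] using hk')
        · simpa [mul_assoc] using h2 (k * g) (by simpa [mul_assoc] using hk)
    · obtain ⟨w, hw, hw1⟩ := hsub (show (1 : G) ∈ nestedBetween S h from
        Or.inl ⟨by simp, by simpa using hdis⟩)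
      obtain rfl : w = g⁻¹ := (inv_eq_of_mul_eq_one_right hw1).symm
      rcases hw with ⟨h1, -⟩ | ⟨h1, -⟩
      · obtain ⟨k, hk, hk'⟩ := ex1 (m + 1)
        rw [hg] at hk
        exact hk' (by simpa using h1 _ hk)
      · obtain ⟨p, hp⟩ := hS.nonempty
        exact h1 _ (hm p hp) (by simpa)
  · simp only [hg] at hm hRh
    have hh : ∀ k, k * h ∈ S → k * g ∈ S := fun k hk => by
      by_contra hc
      exact hRh k hc hk
    refine ih _ ?_ g hm rfl
    refine Set.ncard_lt_ncard ⟨?_, fun hsub => ?_⟩ (finite_nestedBetween hs hS h)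
    · rintro w (⟨h1, h2⟩ | ⟨h1, h2⟩)
      · exact Or.inl ⟨h1, fun k hk hk' => h2 k hk (hh k hk')⟩
      · exact Or.inr ⟨h1, fun k hk => h2 k (hh k hk)⟩
    · have hmem : h ∈ nestedBetween S g := hsub (Or.inr ⟨hdis, fun k hk => hk⟩)
      rcases hmem with ⟨h1, -⟩ | ⟨-, h2⟩
      · obtain ⟨p, hp⟩ := hS.nonempty
        exact hdis p hp (h1 p hp)
      · obtain ⟨k, hk, hk'⟩ := ex2 m
        refine hk' ?_
        have h3 := (hg (k * h⁻¹)).not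
        rw [hadd, inv_mul_cancel_right, not_not] at h3
        simpa using h2 _ (h3.1 hk)

/-- A finitely generated torsion-free group with more than one end in which no proper nonempty
almost invariant set is invariant under a nontrivial element is cyclic. -/
theorem exists_forall_mem_zpowers_of_isCut [Finite ι] (hs : Subgroup.closure (Set.range s) = ⊤)
    (hcut : ∃ S, IsCut s S)
    (hord : ∀ h : G, h ≠ 1 → Function.Injective fun n : ℤ => h ^ n)
    (hinv : ∀ h : G, h ≠ 1 → ∀ A : Set G, (coboundary s A).Finite →
      (∀ g, g ∈ A ↔ h * g ∈ A) → A = ∅ ∨ A = Set.univ) :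
    ∃ t : G, ∀ g, g ∈ Subgroup.zpowers t := by
  classical
  obtain ⟨S₀, hS₀⟩ := hcut
  obtain ⟨S, hS, hcr⟩ := exists_isCut_not_crosses hs hS₀
  have face := exists_mem_inter_rightTranslate hs hS hcr hord hinv
  have face' := exists_mem_inter_rightTranslate hs hS.compl
    (fun g h => hcr g (crosses_compl_left.1 (crosses_compl_right.1 h))) hord hinv
  have htot : ∀ g, (∀ k ∈ S, k * g ∈ S) ∨ ∀ k, k * g ∈ S → k ∈ S := by
    intro g
    by_contra! hc
    obtain ⟨⟨a, ha, ha'⟩, b, hb, hb'⟩ := hc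
    obtain ⟨c, hc, hc'⟩ := face g
    obtain ⟨d, hd, hd'⟩ := face' g
    exact hcr g ⟨⟨c, hc, hc'⟩, ⟨a, ha, ha'⟩, ⟨b, hb', hb⟩, ⟨d, hd, hd'⟩⟩
  have hstab : ∀ h, (∀ k, k ∈ S ↔ k * h ∈ S) → h = 1 := by
    intro h hh
    by_contra hne
    obtain ⟨g', R, hR, hmono, hin, hout⟩ := exists_axis hs hS hcr (hord h hne) (hinv h hne)
    have hz : ∀ (m : ℤ) k, k ∈ S ↔ k * h ^ m ∈ S := by
      intro m
      have : ∀ n : ℕ, ∀ k, k ∈ S ↔ k * h ^ n ∈ S := by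
        intro n
        induction n with
        | zero => simp
        | succ n ih => intro k; rw [pow_succ, ← mul_assoc, ← hh, ih]
      rcases m.eq_nat_or_neg with ⟨n, rfl | rfl⟩
      · simpa using this n
      · intro k
        rw [this n (k * _)]
        simp
    obtain ⟨p, hp⟩ := hS.nonempty
    obtain ⟨q, hq⟩ := hS.compl_nonempty
    have hcrR : Crosses S R := by
      obtain ⟨m1, h1⟩ := hin p
      obtain ⟨m2, h2⟩ := hout p
      obtain ⟨m3, h3⟩ := hin q
      obtain ⟨m4, h4⟩ := hout q
      exact ⟨⟨_, (hz m1 p).1 hp, h1⟩, ⟨_, (hz m2 p).1 hp, h2⟩, ⟨_, fun h => hq ((hz m3 q).2 h), h3⟩,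
        ⟨_, fun h => hq ((hz m4 q).2 h), h4⟩⟩
    rcases hR with rfl | rfl
    · exact hcr _ hcrR
    · exact hcr _ (crosses_compl_right.1 hcrR)
  let ord : LinearOrder G :=
    { le := fun g h => ∀ k, k * g ∈ S → k * h ∈ S
      le_refl := fun g k hk => hk
      le_trans := fun a b c h1 h2 k hk => h2 k (h1 k hk)
      le_antisymm := fun a b h1 h2 => by
        have := hstab (a⁻¹ * b) fun k =>
          ⟨fun hk => by simpa [mul_assoc] using h1 (k * a⁻¹) (by simpa),
            fun hk => by simpa using h2 (k * a⁻¹) (by simpa [mul_assoc] using hk)⟩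
        exact (inv_mul_eq_one.1 this)
      le_total := fun a b => by
        refine (htot (a⁻¹ * b)).imp (fun h k hk => ?_) (fun h k hk => ?_)
        · simpa [mul_assoc] using h _ hk
        · exact h _ (by simpa [mul_assoc] using hk)
      toDecidableLE := Classical.decRel _ }
  have hle : ∀ a b : G, a ≤ b ↔ ∀ k, k * a ∈ S → k * b ∈ S := fun _ _ => Iff.rfl
  have : MulLeftMono G := ⟨fun a b c h => by
    rw [hle] at h ⊢
    intro k hk
    rw [← mul_assoc] at hk ⊢
    exact h _ hk⟩
  have : MulLeftStrictMono G := inferInstance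
  refine exists_forall_mem_zpowers_of_finite_Ioc fun g => ?_
  obtain ⟨p, hp⟩ := hS.nonempty
  obtain ⟨q, hq⟩ := hS.compl_nonempty
  refine (finite_mul_mem_and_mul_notMem hs hS.3 p (q * g⁻¹)).subset ?_
  rintro w ⟨h1, h2⟩
  refine ⟨(hle _ _).1 h1.le p (by simpa), fun h => hq ?_⟩
  simpa using (hle _ _).1 h2 _ h

end Noncrossing

section FreeCriterion

/-- Evaluation of `∑ z_g g` at a function on the group, `∑ z_g φ(g)`. -/
noncomputable def MonoidAlgebra.evalFun {Z H : Type*} [Semiring Z] (φ : H → Z) :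
    MonoidAlgebra Z H →+ Z :=
  (Finsupp.liftAddHom fun g => AddMonoidHom.mulRight (φ g)).comp
    (MonoidAlgebra.coeffAddEquiv : MonoidAlgebra Z H ≃+ (H →₀ Z)).toAddMonoidHom

theorem MonoidAlgebra.evalFun_single {Z H : Type*} [Semiring Z] (φ : H → Z) (g : H) (z : Z) :
    MonoidAlgebra.evalFun φ (MonoidAlgebra.single g z) = z * φ g := by
  simp [MonoidAlgebra.evalFun]

open MonoidAlgebra

/-- Every derivation on a free group with coefficients in functions on a quotient is computed by
Fox derivatives. -/
theorem exists_fox_derivatives {ι H Z : Type*} [Fintype ι] [Group H] [Ring Z] (s : ι → H)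
    (D : FreeGroup ι → H → Z)
    (hD : ∀ v w h, D (v * w) h = D v h + D w (h * FreeGroup.lift s v)) (w : FreeGroup ι) :
    ∃ α : ι → MonoidAlgebra Z H,
      single (FreeGroup.lift s w) 1 - 1 = ∑ i, α i * (single (s i) 1 - 1) ∧
      ∀ h, D w h = ∑ i, evalFun (D (FreeGroup.of i)) (single h 1 * α i) := by
  classical
  have hD1 : ∀ h, D 1 h = 0 := fun h => by simpa using hD 1 1 h
  have hDinv : ∀ w h, D w⁻¹ h = - D w (h * (FreeGroup.lift s w)⁻¹) := by
    intro w h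
    have := hD w⁻¹ w h
    rw [inv_mul_cancel, hD1, map_inv] at this
    exact eq_neg_of_add_eq_zero_left this.symm
  have hinv : ∀ w, (∃ α : ι → MonoidAlgebra Z H,
      single (FreeGroup.lift s w) 1 - 1 = ∑ i, α i * (single (s i) 1 - 1) ∧
      ∀ h, D w h = ∑ i, evalFun (D (FreeGroup.of i)) (single h 1 * α i)) →
      ∃ α : ι → MonoidAlgebra Z H,
      single (FreeGroup.lift s w⁻¹) 1 - 1 = ∑ i, α i * (single (s i) 1 - 1) ∧
      ∀ h, D w⁻¹ h = ∑ i, evalFun (D (FreeGroup.of i)) (single h 1 * α i) := by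
    rintro w ⟨α, h1, h2⟩
    refine ⟨fun i => -(single (FreeGroup.lift s w)⁻¹ 1 * α i), ?_, fun h => ?_⟩
    · simp only [neg_mul, mul_assoc, Finset.sum_neg_distrib, ← Finset.mul_sum, ← h1]
      rw [mul_sub, single_mul_single, map_inv]
      simp [one_def]
    · rw [hDinv, h2]
      simp [← mul_assoc, single_mul_single]
  induction w using FreeGroup.induction_on with
  | C1 => exact ⟨0, by simp [one_def], fun h => by simp [hD1]⟩
  | of i =>
    refine ⟨fun j => if j = i then 1 else 0, ?_, fun h => ?_⟩
    · simp
    · simp [apply_ite, evalFun_single]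
  | inv_of i ih => exact hinv _ ih
  | mul v w hv hw =>
    obtain ⟨α, h1, h2⟩ := hv
    obtain ⟨β, h3, h4⟩ := hw
    refine ⟨fun i => α i + single (FreeGroup.lift s v) 1 * β i, ?_, fun h => ?_⟩
    · simp only [add_mul, Finset.sum_add_distrib, mul_assoc, ← Finset.mul_sum, ← h1, ← h3]
      rw [mul_sub, single_mul_single, map_mul]
      simp
    · rw [hD, h2, h4]
      simp [mul_add, ← mul_assoc, single_mul_single, Finset.sum_add_distrib]

/-- A group generated by `s` is free on `s` if the elements `s i - 1` of some group ring are left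
linearly independent. -/
theorem isFreeGroup_of_independent {ι H : Type} (Z : Type) [Fintype ι] [Group H] [Ring Z]
    [Nontrivial Z] (s : ι → H) (hs : Subgroup.closure (Set.range s) = ⊤)
    (hind : ∀ α : ι → MonoidAlgebra Z H, ∑ i, α i * (single (s i) 1 - 1) = 0 → ∀ i, α i = 0) :
    IsFreeGroup H := by
  set π : FreeGroup ι →* H := FreeGroup.lift s with hπ
  have hsurj : Function.Surjective π := by
    rw [← MonoidHom.range_eq_top, hπ, FreeGroup.range_lift_eq_closure, hs]
  suffices hker : π.ker = ⊥ from
    IsFreeGroup.ofMulEquiv (MulEquiv.ofBijective π ⟨(MonoidHom.ker_eq_bot_iff π).1 hker, hsurj⟩)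
  set τ := Function.surjInv hsurj
  have hτ : ∀ h, π (τ h) = h := Function.surjInv_eq hsurj
  by_cases hgen : IsEmpty (IsFreeGroup.Generators π.ker)
  · have : Subsingleton π.ker :=
      (IsFreeGroup.toFreeGroup π.ker).injective.subsingleton
    exact Subgroup.eq_bot_of_subsingleton _
  obtain ⟨i₀⟩ := not_isEmpty_iff.1 hgen
  exfalso
  set χ : π.ker →* Multiplicative Z :=
    IsFreeGroup.lift fun _ => Multiplicative.ofAdd (1 : Z)
  let D : FreeGroup ι → H → Z := fun w h =>
    (χ ⟨τ h * w * (τ (h * π w))⁻¹, by simp [MonoidHom.mem_ker, hτ]⟩).toAdd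
  have hD : ∀ v w h, D (v * w) h = D v h + D w (h * π v) := by
    intro v w h
    simp only [D]
    rw [← toAdd_mul, ← map_mul χ]
    congr 2
    ext
    simp [mul_assoc]
  set n := IsFreeGroup.of i₀
  obtain ⟨α, h1, h2⟩ := exists_fox_derivatives s D hD (n : FreeGroup ι)
  have hn : π n = 1 := n.2
  have hα := hind α (by rw [← h1, ← hπ, hn]; simp [one_def])
  have h3 : D n 1 = 0 := by rw [h2]; simp [hα]
  have h4 : D n 1 = (χ n).toAdd := by
    have ht : τ 1 ∈ π.ker := hτ 1
    simp only [D]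
    have : (⟨τ 1 * n * (τ (1 * π n))⁻¹, by simp [MonoidHom.mem_ker, hτ]⟩ : π.ker) =
        ⟨τ 1, ht⟩ * n * ⟨τ 1, ht⟩⁻¹ := by
      ext
      simp [hn]
    rw [this, map_mul χ, map_mul χ, map_inv χ, mul_inv_cancel_comm]
  rw [h4] at h3
  have h5 : χ n = Multiplicative.ofAdd 1 := IsFreeGroup.lift_of _ _
  rw [h5] at h3
  exact one_ne_zero h3

/-- A torsion-free cyclic group is free. -/
theorem isFreeGroup_of_forall_mem_zpowers {H : Type} [Group H] {t : H}
    (ht : ∀ g, g ∈ Subgroup.zpowers t)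
    (hord : t ≠ 1 → Function.Injective fun n : ℤ => t ^ n) : IsFreeGroup H := by
  by_cases h1 : t = 1
  · have : Subsingleton H := ⟨fun a b => by
      have ha := ht a
      have hb := ht b
      rw [h1, Subgroup.zpowers_one_eq_bot, Subgroup.mem_bot] at ha hb
      rw [ha, hb]⟩
    have : Unique H := ⟨⟨1⟩, fun a => Subsingleton.elim _ _⟩
    exact IsFreeGroup.ofMulEquiv (MulEquiv.ofUnique : FreeGroup Empty ≃* H)
  · have : Function.Bijective (zpowersHom H t) :=
      ⟨fun a b hab => hord h1 hab, fun g => by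
        obtain ⟨n, hn⟩ := ht g
        exact ⟨Multiplicative.ofAdd n, hn⟩⟩
    exact IsFreeGroup.ofMulEquiv
      (FreeGroup.mulEquivIntOfUnique.trans (MulEquiv.ofBijective _ this) : FreeGroup Unit ≃* H)

end FreeCriterion

section AlmostConstant

variable {H ι Z : Type*} [Group H] [Finite ι] {s : ι → H}

/-- In a group without cuts, almost invariant functions are almost constant. -/
theorem exists_finite_ne_of_not_isCut (hcut : ∀ S, ¬ IsCut s S) (f : H → Z)
    (hf : ∀ k, {g | f (k * g) ≠ f g}.Finite) : ∃ c, {g | f g ≠ c}.Finite := by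
  by_contra! hinf
  have hpre : ∀ P : Set Z, (f ⁻¹' P).Finite ∨ (f ⁻¹' P)ᶜ.Finite := by
    intro P
    by_contra! hc
    refine hcut _ ⟨hc.1, hc.2, ?_⟩
    refine ((Set.finite_iUnion fun i => (hf (s i)).image (Prod.mk i))).subset ?_
    rintro ⟨i, g⟩ he
    refine Set.mem_iUnion.2 ⟨i, g, fun h => he ?_, rfl⟩
    simp only [Set.mem_preimage, h]
  have hfib : ∀ c, (f ⁻¹' {c}).Finite := fun c => (hpre {c}).resolve_right (hinf c)
  have hH : (Set.univ : Set H).Infinite := (hinf (f 1)).mono (Set.subset_univ _)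
  have hrange : (Set.range f).Infinite := by
    intro h
    refine hH ((h.biUnion fun c _ => hfib c).subset fun g _ => ?_)
    simp
  set e := hrange.natEmbedding
  have hmem : ∀ (Q : Set ℕ), Q.Infinite →
      (f ⁻¹' ((fun n => (e n : Z)) '' Q)).Infinite := by
    intro Q hQ
    refine Set.Infinite.preimage (hQ.image ?_) ?_
    · exact (Subtype.val_injective.comp e.injective).injOn
    · rintro _ ⟨n, -, rfl⟩
      exact (e n).2
  rcases hpre ((fun n => (e n : Z)) '' {n | Even n}) with h | h
  · refine hmem _ (Set.infinite_of_injective_forall_mem (f := fun n : ℕ => 2 * n) ?_ ?_) h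
    · exact fun m n hmn => by simpa using hmn
    · exact fun n => even_two_mul n
  · refine hmem {n | Odd n} (Set.infinite_of_injective_forall_mem (f := fun n : ℕ => 2 * n + 1)
      ?_ ?_) (h.subset ?_)
    · exact fun m n hmn => by simpa using hmn
    · exact fun n => odd_two_mul_add_one n
    rintro g ⟨n, hn, hng⟩ ⟨m, hm, hmg⟩
    have : n = m := e.injective (Subtype.ext (hng.trans hmg.symm))
    subst this
    exact (Nat.not_even_iff_odd.2 hn) hm

end AlmostConstant

section Derivations

open MonoidAlgebra

variable {H ι Z U : Type*} [Group H] [Ring Z] [Ring U]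

/-- Derivations from a group to its group ring, with the left multiplication action. -/
def IsGroupDerivation (d : H → MonoidAlgebra Z H) : Prop :=
  ∀ h k, d (h * k) = d h + single h 1 * d k

/-- A linear relation between the elements `s i - 1` is satisfied by the values of every
derivation. -/
theorem IsGroupDerivation.sum_mul_eq_zero [Fintype ι] {d : H → MonoidAlgebra Z H}
    (hd : IsGroupDerivation d) {s : ι → H} {a : ι → MonoidAlgebra Z H}
    (ha : ∑ i, a i * (single (s i) 1 - 1) = 0) : ∑ i, a i * d (s i) = 0 := by
  let Φ : MonoidAlgebra Z H →+ MonoidAlgebra Z H :=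
    (Finsupp.liftAddHom fun g => (AddMonoidHom.mulRight (d g)).comp
      (singleAddHom (1 : H))).comp
      (coeffAddEquiv : MonoidAlgebra Z H ≃+ (H →₀ Z)).toAddMonoidHom
  have hΦ : ∀ g z, Φ (single g z) = single 1 z * d g := fun g z => by simp [Φ]
  have key : ∀ (c : MonoidAlgebra Z H) k, Φ (c * (single k 1 - 1)) = c * d k := by
    intro c k
    induction c using induction_linear with
    | zero => simp
    | add p q hp hq => rw [add_mul, map_add, hp, hq, add_mul]
    | single g z =>
      rw [mul_sub, single_mul_single, map_sub, mul_one, mul_one, hΦ, hΦ, hd, mul_add,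
        add_sub_cancel_left, ← mul_assoc, single_mul_single, one_mul, mul_one]
  simpa [key] using congrArg Φ ha

/-- The inner derivation of an almost invariant function. -/
noncomputable def almostInner (f : H → Z) (hf : ∀ k, {g | f (k * g) ≠ f g}.Finite) (k : H) :
    MonoidAlgebra Z H :=
  ofCoeff (Finsupp.ofSupportFinite (fun g => f (k⁻¹ * g) - f g)
    ((hf k⁻¹).subset fun _ hg => sub_ne_zero.1 hg))

theorem coeff_almostInner (f : H → Z) (hf : ∀ k, {g | f (k * g) ≠ f g}.Finite) (k g : H) :
    (almostInner f hf k).coeff g = f (k⁻¹ * g) - f g := rfl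

theorem isGroupDerivation_almostInner (f : H → Z) (hf : ∀ k, {g | f (k * g) ≠ f g}.Finite) :
    IsGroupDerivation (almostInner f hf) := by
  intro h k
  ext g
  simp [coeff_almostInner, mul_assoc]

theorem single_sub_one_ne_zero [Nontrivial Z] {h : H} (hh : h ≠ 1) :
    (single h 1 - 1 : MonoidAlgebra Z H) ≠ 0 := by
  rw [sub_ne_zero, one_def]
  exact fun h' => hh ((single_left_inj one_ne_zero).1 h')

variable {ψ : MonoidAlgebra Z H →+* U}

/-- A derivation that is inner over `U` on generators is inner over `U`. -/
theorem IsGroupDerivation.map_eq {d : H → MonoidAlgebra Z H} (hd : IsGroupDerivation d)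
    {s : ι → H} (hs : Subgroup.closure (Set.range s) = ⊤) {u : U}
    (hu : ∀ i, ψ (d (s i)) = ψ (single (s i) 1 - 1) * u) (k : H) :
    ψ (d k) = ψ (single k 1 - 1) * u := by
  have hd1 : d 1 = 0 := by
    have := hd 1 1
    rw [mul_one, ← one_def, one_mul] at this
    simpa using this
  have hk : k ∈ Subgroup.closure (Set.range s) := hs ▸ Subgroup.mem_top k
  induction hk using Subgroup.closure_induction with
  | mem _ hx => obtain ⟨i, rfl⟩ := hx; exact hu i
  | one => simp [hd1, ← one_def]
  | mul a b _ _ ha hb =>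
    rw [hd, map_add, map_mul, ha, hb, ← mul_assoc, ← map_mul, ← add_mul, ← map_add]
    congr 2
    rw [mul_sub, single_mul_single, mul_one, mul_one]
    abel
  | inv a _ ha =>
    have h1 := hd a⁻¹ a
    rw [inv_mul_cancel, hd1] at h1
    rw [eq_neg_of_add_eq_zero_left h1.symm, map_neg, map_mul, ha, ← mul_assoc, ← map_mul,
      ← neg_mul, ← map_neg]
    congr 2
    rw [mul_sub, single_mul_single, mul_one, mul_one, inv_mul_cancel, ← one_def]
    abel

/-- If an element of `U` is multiplied into the group ring by the augmentation ideal, then it comes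
from the group ring, unless the group has a cut. -/
theorem exists_map_eq_of_not_isCut [Finite ι] [Nontrivial Z] [Nontrivial H]
    (hψ : Function.Injective ψ) (hunit : ∀ a, a ≠ 0 → IsUnit (ψ a)) {s : ι → H}
    (hcut : ∀ S, ¬ IsCut s S) {u : U}
    (hu : ∀ k, ∃ p, ψ p = ψ (single k 1 - 1) * u) : ∃ q, ψ q = u := by
  choose d hd using hu
  have hder : IsGroupDerivation d := by
    intro h k
    apply hψ
    rw [map_add, map_mul, hd, hd, hd, ← mul_assoc, ← map_mul, ← add_mul, ← map_add]
    congr 2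
    rw [mul_sub, single_mul_single, mul_one, mul_one]
    abel
  have hf : ∀ k g, (d (k * g)⁻¹).coeff 1 = (d g⁻¹).coeff 1 + (d k⁻¹).coeff g := by
    intro k g
    rw [mul_inv_rev, hder]
    simp
  obtain ⟨c, hc⟩ := exists_finite_ne_of_not_isCut hcut (fun g => (d g⁻¹).coeff 1) fun k =>
    (d k⁻¹).coeff.hasFiniteSupport.subset fun g hg hg0 => hg (by rw [hf, hg0, add_zero])
  let q : MonoidAlgebra Z H := ofCoeff (Finsupp.ofSupportFinite (fun g => (d g⁻¹).coeff 1 - c)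
    (hc.subset fun g hg => sub_ne_zero.1 hg))
  have hq : ∀ g, q.coeff g = (d g⁻¹).coeff 1 - c := fun _ => rfl
  obtain ⟨k, hk⟩ := exists_ne (1 : H)
  have hdk : d k = (single k 1 - 1) * q := by
    ext g
    have := hf k⁻¹ g
    rw [inv_inv] at this
    rw [sub_mul, one_mul, coeff_sub, Finsupp.sub_apply, coeff_single_mul_apply, hq, hq, this]
    simp
  refine ⟨q, (hunit _ (single_sub_one_ne_zero (Z := Z) hk)).mul_left_cancel ?_⟩
  rw [← map_mul, ← hdk, hd]

theorem mul_eq_zero_of_isUnit (hψ : Function.Injective ψ) (hunit : ∀ a, a ≠ 0 → IsUnit (ψ a))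
    {a b : MonoidAlgebra Z H} (ha : a ≠ 0) (hab : a * b = 0) : b = 0 := by
  apply hψ
  apply (hunit a ha).mul_left_cancel
  rw [← map_mul, hab, map_zero, mul_zero]

/-- The group is torsion-free. -/
theorem zpow_injective_of_isUnit [Nontrivial Z] (hψ : Function.Injective ψ)
    (hunit : ∀ a, a ≠ 0 → IsUnit (ψ a)) {h : H} (hh : h ≠ 1) :
    Function.Injective fun n : ℤ => h ^ n := by
  rw [injective_zpow_iff_not_isOfFinOrder]
  intro hfin
  have hpow : ∀ n, (single h 1 : MonoidAlgebra Z H) ^ n = single (h ^ n) 1 := by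
    intro n
    simp [single_pow]
  have h1 := mul_geom_sum (single h 1 : MonoidAlgebra Z H) (orderOf h)
  rw [hpow, pow_orderOf_eq_one, ← one_def, sub_self] at h1
  have h2 := mul_eq_zero_of_isUnit hψ hunit (single_sub_one_ne_zero hh) h1
  have h3 : (∑ i ∈ Finset.range (orderOf h), (single h 1 : MonoidAlgebra Z H) ^ i).coeff 1 = 1 := by
    simp only [hpow, coeff_sum, coeff_single, Finsupp.finsetSum_apply]
    rw [Finset.sum_eq_single 0]
    · simp
    · intro i hi hi0
      refine Finsupp.single_eq_of_ne ?_
      intro hc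
      exact pow_ne_one_of_lt_orderOf hi0 (Finset.mem_range.1 hi) hc.symm
    · intro hc
      exact absurd (Finset.mem_range.2 hfin.orderOf_pos) hc
  rw [h2] at h3
  exact zero_ne_one h3

/-- Two solutions of a relation between `s 0 - 1` and `s 1 - 1` are proportional over `U`. -/
theorem exists_eq_mul_of_relation [Nontrivial Z] (hunit : ∀ a, a ≠ 0 → IsUnit (ψ a))
    {s : Fin 2 → H} (hs1 : s 0 ≠ 1) {a : Fin 2 → MonoidAlgebra Z H} (ha : a 1 ≠ 0)
    (hrel : ∑ i, a i * (single (s i) 1 - 1) = 0) {p : Fin 2 → MonoidAlgebra Z H}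
    (hp : ∑ i, a i * p i = 0) : ∃ u : U, ∀ i, ψ (p i) = ψ (single (s i) 1 - 1) * u := by
  obtain ⟨v, hv⟩ := hunit _ (single_sub_one_ne_zero (Z := Z) hs1)
  have h0 : ψ (p 0) = ψ (single (s 0) 1 - 1) * (↑v⁻¹ * ψ (p 0)) := by
    rw [← hv, ← mul_assoc, Units.mul_inv, one_mul]
  refine ⟨↑v⁻¹ * ψ (p 0), fun i => ?_⟩
  fin_cases i
  · exact h0
  · apply (hunit _ ha).mul_left_cancel
    have h1 := congrArg ψ hrel
    have h2 := congrArg ψ hp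
    rw [Fin.sum_univ_two, map_add, map_mul, map_mul, map_zero] at h1 h2
    simp only [Fin.mk_one]
    rw [← mul_assoc, eq_neg_of_add_eq_zero_right h1, eq_neg_of_add_eq_zero_right h2, neg_mul,
      mul_assoc, ← h0]

theorem eq_empty_or_univ_of_mul_mem_iff_of_relation [Nontrivial Z] (hψ : Function.Injective ψ)
    (hunit : ∀ a, a ≠ 0 → IsUnit (ψ a)) {s : Fin 2 → H}
    (hs : Subgroup.closure (Set.range s) = ⊤) (hs1 : s 0 ≠ 1)
    {a : Fin 2 → MonoidAlgebra Z H} (ha : a 1 ≠ 0)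
    (hrel : ∑ i, a i * (single (s i) 1 - 1) = 0) {h : H} (hh : h ≠ 1) {A : Set H}
    (hA : (coboundary s A).Finite) (hhA : ∀ g, g ∈ A ↔ h * g ∈ A) : A = ∅ ∨ A = Set.univ := by
  classical
  have hf : ∀ k, {g | A.indicator (1 : H → Z) (k * g) ≠ A.indicator 1 g}.Finite := fun k =>
    (finite_mul_mem_xor hs hA k).subset fun g hg hc => hg (by
      by_cases hgA : g ∈ A
      · rw [Set.indicator_of_mem hgA, Set.indicator_of_mem (hc.1 hgA)]; rfl
      · rw [Set.indicator_of_notMem hgA, Set.indicator_of_notMem (fun h => hgA (hc.2 h))])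
  have hd := isGroupDerivation_almostInner _ hf
  obtain ⟨u, hu⟩ := exists_eq_mul_of_relation hunit hs1 ha hrel (hd.sum_mul_eq_zero hrel)
  have hdu := hd.map_eq hs hu
  have hdh : almostInner _ hf h = 0 := by
    ext g
    rw [coeff_almostInner, coeff_zero, Finsupp.zero_apply, sub_eq_zero]
    have := hhA (h⁻¹ * g)
    rw [mul_inv_cancel_left] at this
    by_cases hgA : g ∈ A
    · rw [Set.indicator_of_mem hgA, Set.indicator_of_mem (this.2 hgA)]; rfl
    · rw [Set.indicator_of_notMem hgA, Set.indicator_of_notMem (fun h => hgA (this.1 h))]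
  have hu0 : u = 0 := by
    apply (hunit _ (single_sub_one_ne_zero (Z := Z) hh)).mul_left_cancel
    rw [← hdu, hdh, map_zero, mul_zero]
  have hd0 : ∀ k, almostInner _ hf k = 0 := fun k => hψ (by rw [hdu, hu0, mul_zero, map_zero])
  refine eq_empty_or_univ_of_mul_mem_iff hs fun i g => ?_
  have := congrArg (fun w => coeff w g) (hd0 (s i)⁻¹)
  simp only [coeff_almostInner, inv_inv, coeff_zero, Finsupp.zero_apply, sub_eq_zero] at this
  have h2 : ∀ k, A.indicator (1 : H → Z) k = 1 ↔ k ∈ A := fun k => by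
    by_cases hk : k ∈ A <;> simp [hk]
  rw [← h2, ← h2, this]

/-- A group generated by two nontrivial elements, with a nontrivial relation between `s 0 - 1` and
`s 1 - 1` and enough solutions of that relation, is cyclic. -/
theorem exists_forall_mem_zpowers_of_relation {Z' J : Type*} [Fintype J] [Ring Z'] [Nontrivial Z']
    [Nontrivial Z] (hψ : Function.Injective ψ) (hunit : ∀ a, a ≠ 0 → IsUnit (ψ a)) {s : Fin 2 → H}
    (hs : Subgroup.closure (Set.range s) = ⊤) (hs1 : s 0 ≠ 1)
    {a : Fin 2 → MonoidAlgebra Z H} (ha : a 1 ≠ 0)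
    (hrel : ∑ i, a i * (single (s i) 1 - 1) = 0) (ε : MonoidAlgebra Z H →+* Z')
    (c : J → Fin 2 → MonoidAlgebra Z H) (v : J → MonoidAlgebra Z H)
    (hc : ∀ j, ∑ i, a i * c j i = 0) (hv : ∀ j, ε (v j) = 0)
    (hcv : single (s 0) 1 - 1 = ∑ j, c j 0 * v j) : ∃ t : H, ∀ g, g ∈ Subgroup.zpowers t := by
  refine exists_forall_mem_zpowers_of_isCut hs ?_ (fun h => zpow_injective_of_isUnit hψ hunit)
    fun h hh A hA hhA =>
      eq_empty_or_univ_of_mul_mem_iff_of_relation hψ hunit hs hs1 ha hrel hh hA hhA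
  by_contra! hcut
  have : Nontrivial H := ⟨⟨s 0, 1, hs1⟩⟩
  have hq : ∀ j, ∃ q, c j 0 = (single (s 0) 1 - 1) * q := by
    intro j
    obtain ⟨u, hu⟩ := exists_eq_mul_of_relation hunit hs1 ha hrel (hc j)
    obtain ⟨q, hq⟩ := exists_map_eq_of_not_isCut hψ hunit hcut (u := u) fun k => by
      have hk : k ∈ Subgroup.closure (Set.range s) := hs ▸ Subgroup.mem_top k
      induction hk using Subgroup.closure_induction with
      | mem _ hx => obtain ⟨i, rfl⟩ := hx; exact ⟨_, hu i⟩
      | one => exact ⟨0, by simp [← one_def]⟩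
      | mul a b _ _ ha hb =>
        obtain ⟨p, hp⟩ := ha
        obtain ⟨r, hr⟩ := hb
        refine ⟨p + single a 1 * r, ?_⟩
        rw [map_add, map_mul, hp, hr, ← mul_assoc, ← map_mul, ← add_mul, ← map_add]
        congr 2
        rw [mul_sub, single_mul_single, mul_one, mul_one]
        abel
      | inv a _ ha =>
        obtain ⟨p, hp⟩ := ha
        refine ⟨-(single a⁻¹ 1 * p), ?_⟩
        rw [map_neg, map_mul, hp, ← mul_assoc, ← map_mul, ← neg_mul, ← map_neg]
        congr 2
        rw [mul_sub, single_mul_single, mul_one, mul_one, inv_mul_cancel, ← one_def]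
        abel
    exact ⟨q, hψ (by rw [hu, map_mul, hq])⟩
  choose q hq using hq
  have h1 : (single (s 0) 1 - 1 : MonoidAlgebra Z H) * (∑ j, q j * v j - 1) = 0 := by
    rw [mul_sub, mul_one, Finset.mul_sum, sub_eq_zero]
    conv_rhs => rw [hcv]
    simp only [hq, mul_assoc]
  have h2 := congrArg ε (mul_eq_zero_of_isUnit hψ hunit (single_sub_one_ne_zero hs1) h1)
  simp [hv] at h2

end Derivations

section Flat

open MulOpposite

variable {A F ι : Type} [Ring A] [AddCommGroup F] [Module A F]

/-- The additive subgroup of `ι → F` spanned by the vectors `(c k • n)` with `c ∈ K`. -/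
def spanSMul (F : Type) [AddCommGroup F] [Module A F] (K : Set (ι → A)) : AddSubgroup (ι → F) :=
  AddSubgroup.closure {v | ∃ c ∈ K, ∃ n : F, v = fun k => c k • n}

theorem smul_mem_spanSMul {K : Set (ι → A)} {c : ι → A} (hc : c ∈ K) (n : F) :
    (fun k => c k • n) ∈ spanSMul F K :=
  AddSubgroup.subset_closure ⟨c, hc, n, rfl⟩

/-- The balanced map presenting the tensor product of `(ι → A) ⧸ K` and `F`. -/
noncomputable def quotientTensor (F : Type) [AddCommGroup F] [Module A F]
    (K : Submodule Aᵐᵒᵖ (ι → A)) (q : (ι → A) ⧸ K) (n : F) :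
    (ι → F) ⧸ spanSMul F (K : Set (ι → A)) :=
  QuotientAddGroup.mk fun k => (Quotient.out q) k • n

theorem quotientTensor_mk (K : Submodule Aᵐᵒᵖ (ι → A)) (c : ι → A) (n : F) :
    quotientTensor F K (Submodule.Quotient.mk c) n = QuotientAddGroup.mk fun k => c k • n := by
  rw [quotientTensor, QuotientAddGroup.eq]
  have h : -Quotient.out (Submodule.Quotient.mk c : (ι → A) ⧸ K) + c ∈ K := by
    rw [neg_add_eq_sub, ← Submodule.Quotient.eq]
    exact (Quotient.out_eq _).symm
  convert smul_mem_spanSMul (F := F) (SetLike.mem_coe.2 h) n using 2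
  simp [add_smul]

theorem sum_mk_single_eq [Fintype ι] [DecidableEq ι] (K : Submodule Aᵐᵒᵖ (ι → A)) (c : ι → A) :
    ∑ k, op (c k) • (Submodule.Quotient.mk (Pi.single k 1) : (ι → A) ⧸ K) =
      Submodule.Quotient.mk c := by
  have h : c = ∑ k, op (c k) • (Pi.single k 1 : ι → A) := by
    ext i
    simp [Finset.sum_apply, Pi.single_apply]
  conv_rhs => rw [h]
  rw [← Submodule.mkQ_apply, map_sum]
  rfl

theorem isBalancedProduct_quotientTensor [Fintype ι] (K : Submodule Aᵐᵒᵖ (ι → A)) :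
    IsBalancedProduct A ((ι → A) ⧸ K) F _ (quotientTensor F K) := by
  classical
  refine ⟨?_, ?_, ?_, ?_⟩
  · intro p q n
    obtain ⟨c, rfl⟩ := Submodule.Quotient.mk_surjective K p
    obtain ⟨d, rfl⟩ := Submodule.Quotient.mk_surjective K q
    rw [← Submodule.Quotient.mk_add]
    simp only [quotientTensor_mk, Pi.add_apply, add_smul]
    rfl
  · intro p n n'
    simp only [quotientTensor, smul_add]
    rfl
  · intro p a n
    obtain ⟨c, rfl⟩ := Submodule.Quotient.mk_surjective K p
    change quotientTensor F K (Submodule.Quotient.mk (op a • c)) n = _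
    rw [quotientTensor_mk, quotientTensor_mk]
    simp [mul_smul]
  · intro T' _ b' hadd hadd' hbal
    let β : (ι → A) ⧸ K →+ F →+ T' :=
      AddMonoidHom.mk' (fun p => AddMonoidHom.mk' (b' p) (hadd' p))
        fun p q => AddMonoidHom.ext fun n => hadd p q n
    have hβ : ∀ p n, b' p n = β p n := fun _ _ => rfl
    let g : (ι → F) →+ T' :=
      ∑ k, (β (Submodule.Quotient.mk (Pi.single k 1))).comp (Pi.evalAddMonoidHom (fun _ => F) k)
    have hg : ∀ c n, g (fun k => c k • n) = b' (Submodule.Quotient.mk c) n := by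
      intro c n
      rw [← sum_mk_single_eq, hβ, map_sum, AddMonoidHom.finsetSum_apply]
      simp only [AddMonoidHom.finsetSum_apply, ← hβ, hbal]
      rfl
    have hgK : spanSMul F (K : Set (ι → A)) ≤ g.ker := by
      refine (AddSubgroup.closure_le _).2 ?_
      rintro _ ⟨c, hc, n, rfl⟩
      rw [SetLike.mem_coe, AddMonoidHom.mem_ker, hg, (Submodule.Quotient.mk_eq_zero K).2 hc, hβ,
        map_zero, AddMonoidHom.zero_apply]
    refine ⟨QuotientAddGroup.lift _ g hgK, ?_, ?_⟩
    · intro p n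
      obtain ⟨c, rfl⟩ := Submodule.Quotient.mk_surjective K p
      rw [quotientTensor_mk, ← hg]
      rfl
    · intro g' hg'
      refine QuotientAddGroup.addMonoidHom_ext _ (AddMonoidHom.ext fun m => ?_)
      have hm : m = ∑ k, fun i => (Pi.single k (1 : A) : ι → A) i • m k := by
        ext i
        simp [Finset.sum_apply, Pi.single_apply]
      simp only [AddMonoidHom.comp_apply]
      conv_lhs => rw [hm]
      rw [map_sum, map_sum]
      change _ = g m
      simp only [g, AddMonoidHom.finsetSum_apply]
      refine Finset.sum_congr rfl fun k _ => ?_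
      rw [QuotientAddGroup.mk'_apply, ← quotientTensor_mk, hg']
      rfl

theorem isBalancedProduct_smul : IsBalancedProduct A A F F (fun a n => a • n) := by
  refine ⟨add_smul, smul_add, fun a c n => mul_smul a c n, ?_⟩
  intro T' _ b' hadd hadd' hbal
  have hb : ∀ a n, b' 1 (a • n) = b' a n := fun a n => by rw [← hbal]; simp
  refine ⟨AddMonoidHom.mk' (b' 1) (hadd' 1), hb, fun g hg => ?_⟩
  ext n
  simpa using hg 1 n

/-- The equational criterion for flatness, for a single relation. -/
theorem IsFlatLeftModule.mem_spanSMul [Fintype ι] (hF : IsFlatLeftModule A F) (T : ι → A)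
    (m : ι → F) (hm : ∑ k, T k • m k = 0) :
    m ∈ spanSMul F {c : ι → A | ∑ k, T k * c k = 0} := by
  let θ : (ι → A) →ₗ[Aᵐᵒᵖ] A :=
    { toFun := fun c => ∑ k, T k * c k
      map_add' := fun c d => by simp [mul_add, Finset.sum_add_distrib]
      map_smul' := fun a c => by simp [Finset.sum_mul, mul_assoc] }
  let h : (ι → F) →+ F := AddMonoidHom.mk' (fun m => ∑ k, T k • m k)
    fun m n => by simp [smul_add, Finset.sum_add_distrib]
  have hh : spanSMul F (LinearMap.ker θ : Set (ι → A)) ≤ h.ker := by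
    refine (AddSubgroup.closure_le _).2 ?_
    rintro _ ⟨c, hc, n, rfl⟩
    have hc' : ∑ k, T k * c k = 0 := hc
    simp [h, AddMonoidHom.mem_ker, ← mul_smul, ← Finset.sum_smul, hc']
  have hinj := hF _ _ _ _ _ _ ((LinearMap.ker θ).liftQ θ le_rfl)
    (LinearMap.ker_eq_bot.1 (Submodule.ker_liftQ_eq_bot _ _ _ le_rfl)) _ _ _ _ _ _
    (isBalancedProduct_quotientTensor (LinearMap.ker θ)) isBalancedProduct_smul
    (QuotientAddGroup.lift _ h hh) (by
      intro p n
      obtain ⟨c, rfl⟩ := Submodule.Quotient.mk_surjective _ p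
      rw [quotientTensor_mk, QuotientAddGroup.lift_mk, Submodule.liftQ_apply]
      simp [h, θ, ← mul_smul, Finset.sum_smul])
  have h0 : (QuotientAddGroup.mk m : (ι → F) ⧸ spanSMul F (LinearMap.ker θ : Set (ι → A))) = 0 :=
    hinj (by rw [QuotientAddGroup.lift_mk, map_zero]; exact hm)
  exact (QuotientAddGroup.eq_zero_iff m).1 h0

end Flat

section Restriction

open MonoidAlgebra

variable {Z G : Type} [Ring Z] [Group G] {H : Subgroup G}

/-- The inclusion of the group ring of a subgroup. -/
noncomputable def subgroupInclusion (Z : Type) [Ring Z] (H : Subgroup G) :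
    MonoidAlgebra Z H →+* MonoidAlgebra Z G :=
  mapDomainRingHom Z H.subtype

theorem subgroupInclusion_single (h : H) (z : Z) :
    subgroupInclusion Z H (single h z) = single (h : G) z :=
  mapDomain_single

theorem subgroupInclusion_injective : Function.Injective (subgroupInclusion Z H) :=
  mapDomain_injective H.subtype_injective

/-- The component of an element of the group ring in the right coset of `t`. -/
noncomputable def cosetComponent (Z : Type) [Ring Z] (H : Subgroup G) (t : G) :
    MonoidAlgebra Z G →+ MonoidAlgebra Z H :=
  comapDomainAddMonoidHom (fun h : H => (h : G) * t)
    ((mul_left_injective t).comp Subtype.val_injective)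

theorem coeff_cosetComponent (t : G) (c : MonoidAlgebra Z G) (h : H) :
    (cosetComponent Z H t c).coeff h = c.coeff (h * t) := by
  simp [cosetComponent]

theorem cosetComponent_subgroupInclusion_mul (t : G) (T : MonoidAlgebra Z H)
    (c : MonoidAlgebra Z G) :
    cosetComponent Z H t (subgroupInclusion Z H T * c) = T * cosetComponent Z H t c := by
  induction T using induction_linear with
  | zero => simp
  | add p q hp hq => rw [map_add, add_mul, map_add, hp, hq, add_mul]
  | single h z =>
    ext k
    simp [subgroupInclusion_single, coeff_cosetComponent, coeff_single_mul_apply, mul_assoc]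

theorem coeff_subgroupInclusion_coe (p : MonoidAlgebra Z H) (h : H) :
    (subgroupInclusion Z H p).coeff h = p.coeff h :=
  Finsupp.mapDomain_apply H.subtype_injective _ _

theorem coeff_subgroupInclusion_of_notMem (p : MonoidAlgebra Z H) {g : G} (hg : g ∉ H) :
    (subgroupInclusion Z H p).coeff g = 0 :=
  Finsupp.mapDomain_of_notMem_range _ _ (by simpa using hg)

theorem sum_cosetComponent_mul_single (c : MonoidAlgebra Z G)
    (Q : Finset (Quotient (QuotientGroup.rightRel H)))
    (hQ : ∀ g ∈ c.coeff.support, Quotient.mk _ g ∈ Q) :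
    ∑ q ∈ Q, subgroupInclusion Z H (cosetComponent Z H q.out c) * single q.out 1 = c := by
  classical
  ext g
  have hmem : ∀ q : Quotient (QuotientGroup.rightRel H),
      g * q.out⁻¹ ∈ H ↔ Quotient.mk _ g = q := by
    intro q
    conv_rhs => rw [← q.out_eq, eq_comm, Quotient.eq]
    exact QuotientGroup.rightRel_apply.symm
  have key : ∀ q : Quotient (QuotientGroup.rightRel H),
      (subgroupInclusion Z H (cosetComponent Z H q.out c) * single q.out 1).coeff g =
        if Quotient.mk _ g = q then c.coeff g else 0 := by
    intro q
    rw [coeff_mul_single_apply, mul_one]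
    split_ifs with h
    · have := coeff_subgroupInclusion_coe (cosetComponent Z H q.out c) ⟨_, (hmem q).2 h⟩
      rw [this, coeff_cosetComponent]
      simp
    · exact coeff_subgroupInclusion_of_notMem _ (mt (hmem q).1 h)
  rw [coeff_sum, Finsupp.finsetSum_apply, Finset.sum_congr rfl fun q _ => key q,
    Finset.sum_ite_eq]
  split_ifs with h
  · rfl
  · by_contra hne
    exact h (hQ g (Finsupp.mem_support_iff.2 (Ne.symm hne)))

/-- The equational criterion for flatness over `ZG`, for a single relation with coefficients in
the group ring of a subgroup. -/
theorem IsFlatLeftModule.exists_of_sum_smul_eq_zero {F κ : Type} [AddCommGroup F]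
    [Module (MonoidAlgebra Z G) F] [Fintype κ] (hF : IsFlatLeftModule (MonoidAlgebra Z G) F)
    (T : κ → MonoidAlgebra Z H) (m : κ → F) (hm : ∑ k, subgroupInclusion Z H (T k) • m k = 0) :
    ∃ (J : Type) (_ : Fintype J) (c : J → κ → MonoidAlgebra Z H) (n : J → F),
      (∀ j, ∑ k, T k * c j k = 0) ∧ ∀ k, m k = ∑ j, subgroupInclusion Z H (c j k) • n j := by
  classical
  have h := hF.mem_spanSMul _ m hm
  have hle : spanSMul F {c : κ → MonoidAlgebra Z G | ∑ k, subgroupInclusion Z H (T k) * c k = 0} ≤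
      AddSubgroup.closure {v : κ → F | ∃ c : κ → MonoidAlgebra Z H, ∑ k, T k * c k = 0 ∧
        ∃ n : F, v = fun k => subgroupInclusion Z H (c k) • n} := by
    refine (AddSubgroup.closure_le _).2 ?_
    rintro _ ⟨c, hc, n, rfl⟩
    have hc' : ∑ k, subgroupInclusion Z H (T k) * c k = 0 := hc
    let Q : Finset (Quotient (QuotientGroup.rightRel H)) :=
      Finset.univ.biUnion fun k => (c k).coeff.support.image (Quotient.mk _)
    have hsum : (fun k => c k • n) = ∑ q ∈ Q, fun k =>
        subgroupInclusion Z H (cosetComponent Z H q.out (c k)) • (single q.out (1 : Z) • n) := by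
      ext k
      rw [Finset.sum_apply]
      conv_lhs => rw [← sum_cosetComponent_mul_single (c k) Q fun g hg =>
        Finset.mem_biUnion.2 ⟨k, Finset.mem_univ k, Finset.mem_image_of_mem _ hg⟩]
      simp_rw [Finset.sum_smul, mul_smul]
    rw [hsum, SetLike.mem_coe]
    refine sum_mem fun q _ => AddSubgroup.subset_closure ⟨_, ?_, _, rfl⟩
    simp_rw [← cosetComponent_subgroupInclusion_mul, ← map_sum, hc', map_zero]
  replace h := hle h
  clear hm
  induction h using AddSubgroup.closure_induction with
  | mem v hv =>
    obtain ⟨c, hc, n, rfl⟩ := hv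
    exact ⟨Unit, inferInstance, fun _ => c, fun _ => n, fun _ => hc, fun k => by simp⟩
  | zero => exact ⟨Empty, inferInstance, Empty.elim, Empty.elim, fun j => j.elim, fun k => by simp⟩
  | add v w _ _ hv hw =>
    obtain ⟨J, _, c, n, hc, hn⟩ := hv
    obtain ⟨J', _, c', n', hc', hn'⟩ := hw
    refine ⟨J ⊕ J', inferInstance, Sum.elim c c', Sum.elim n n', ?_, fun k => ?_⟩
    · rintro (j | j)
      · exact hc j
      · exact hc' j
    · simp [hn, hn']
  | neg v _ hv =>
    obtain ⟨J, _, c, n, hc, hn⟩ := hv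
    exact ⟨J, inferInstance, c, fun j => -n j, hc, fun k => by simp [hn]⟩

end Restriction

section Chase

open MonoidAlgebra

variable {Z G : Type} [Ring Z] [Group G] {H : Subgroup G}

theorem augmentationRingHom_single (g : G) (z : Z) :
    augmentationRingHom Z G (single g z) = z := by
  simp [augmentationRingHom]

theorem augmentationRingHom_subgroupInclusion (p : MonoidAlgebra Z H) :
    augmentationRingHom Z G (subgroupInclusion Z H p) = augmentationRingHom Z H p := by
  induction p using induction_linear with
  | zero => simp
  | add p q hp hq => rw [map_add, map_add, map_add, hp, hq]
  | single h z => rw [subgroupInclusion_single, augmentationRingHom_single,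
      augmentationRingHom_single]

/-- The value in `Z` of an element of the trivial module. -/
def TrivialModule.toRing : TrivialModule Z G →+ Z := AddMonoidHom.id Z

theorem TrivialModule.toRing_smul (p : MonoidAlgebra Z H) (z : TrivialModule Z G) :
    toRing (subgroupInclusion Z H p • z) = augmentationRingHom Z H p * toRing z := by
  rw [← augmentationRingHom_subgroupInclusion]
  rfl

/-- A flat resolution of length one of the trivial module turns a relation between `s 0 - 1` and
`s 1 - 1` into an expression of `s 0 - 1` through solutions of that relation and elements of the
augmentation ideal. -/
theorem exists_eq_sum_of_relation {F₁ F₀ : Type} [AddCommGroup F₁]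
    [Module (MonoidAlgebra Z G) F₁] [AddCommGroup F₀] [Module (MonoidAlgebra Z G) F₀]
    (f : F₁ →ₗ[MonoidAlgebra Z G] F₀) (e : F₀ →ₗ[MonoidAlgebra Z G] TrivialModule Z G)
    (hf : Function.Injective f) (he : Function.Surjective e) (hfe : Function.Exact f e)
    (h₁ : IsFlatLeftModule (MonoidAlgebra Z G) F₁) (h₀ : IsFlatLeftModule (MonoidAlgebra Z G) F₀)
    (s : Fin 2 → H) (a : Fin 2 → MonoidAlgebra Z H)
    (hrel : ∑ i, a i * (single (s i) 1 - 1) = 0) :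
    ∃ (J : Type) (_ : Fintype J) (c : J → Fin 2 → MonoidAlgebra Z H) (v : J → MonoidAlgebra Z H),
      (∀ j, ∑ i, a i * c j i = 0) ∧ (∀ j, augmentationRingHom Z H (v j) = 0) ∧
      single (s 0) 1 - 1 = ∑ j, c j 0 * v j := by
  obtain ⟨e₀, he₀⟩ := he (1 : Z)
  have haug : ∀ i, augmentationRingHom Z H (single (s i) 1 - 1) = 0 := fun i => by
    rw [map_sub, map_one, augmentationRingHom_single, sub_self]
  have hn : ∀ i, ∃ n, f n = subgroupInclusion Z H (single (s i) 1 - 1) • e₀ := fun i => by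
    have h : TrivialModule.toRing (e (subgroupInclusion Z H (single (s i) 1 - 1) • e₀)) = 0 := by
      rw [map_smul, TrivialModule.toRing_smul, haug, zero_mul]
    exact (hfe _).1 h
  choose n hn using hn
  obtain ⟨J, _, c, k, hc, hk⟩ := h₁.exists_of_sum_smul_eq_zero a n <| hf <| by
    simp_rw [map_sum, map_smul, hn, ← mul_smul, ← map_mul, ← Finset.sum_smul, ← map_sum, hrel,
      map_zero, zero_smul]
  obtain ⟨L, _, d, l, hd, hl⟩ := h₀.exists_of_sum_smul_eq_zero
    (fun j : Option J => j.elim (single (s 0) 1 - 1) fun j => -c j 0)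
    (fun j => j.elim e₀ fun j => f (k j)) <| by
      rw [Fintype.sum_option]
      simp only [Option.elim, map_neg, neg_smul, Finset.sum_neg_distrib]
      rw [← hn 0, hk 0, map_sum]
      simp_rw [map_smul]
      exact add_neg_cancel _
  let z : L → Z := fun i => TrivialModule.toRing (e (l i))
  have hz : ∀ j : Option J, augmentationRingHom Z H (∑ i, d i j * single 1 (z i)) =
      TrivialModule.toRing (e (j.elim e₀ fun j => f (k j))) := fun j => by
    rw [hl j, map_sum, map_sum, map_sum]
    refine Finset.sum_congr rfl fun i _ => ?_
    rw [map_mul, augmentationRingHom_single, map_smul, TrivialModule.toRing_smul]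
  refine ⟨Option J, inferInstance,
    fun j => j.elim (fun i => -(single (s i) 1 - 1)) c,
    fun j => j.elim (∑ i, d i none * single 1 (z i) - 1)
      fun j => ∑ i, d i (some j) * single 1 (z i), ?_, ?_, ?_⟩
  · rintro (_ | j)
    · simpa only [Option.elim, mul_neg, Finset.sum_neg_distrib, neg_eq_zero] using hrel
    · exact hc j
  · rintro (_ | j)
    · simp only [Option.elim]
      rw [map_sub, map_one, hz none, sub_eq_zero]
      exact he₀
    · refine (hz (some j)).trans ?_
      exact (hfe _).2 ⟨k j, rfl⟩
  · have hd' : ∀ i, (single (s 0) 1 - 1) * d i none = ∑ j, c j 0 * d i (some j) := fun i => by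
      have := hd i
      rw [Fintype.sum_option] at this
      simpa only [Option.elim, neg_mul, Finset.sum_neg_distrib, add_neg_eq_zero] using this
    rw [Fintype.sum_option]
    simp only [Option.elim]
    rw [mul_sub, Finset.mul_sum, mul_one]
    simp_rw [Finset.mul_sum, ← mul_assoc]
    rw [Finset.sum_comm]
    simp_rw [← Finset.sum_mul, ← hd', neg_mul, Finset.sum_neg_distrib]
    abel

end Chase

/-- Let `Z`, `U` be nonzero rings with `ZG` a subring of `U`
(via an injective ring homomorphism `φ`) such that every nonzero element of
`ZG` becomes invertible in `U`.  If the trivial left `ZG`-module `Z` admits a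
flat resolution of length at most one, i.e. there is an exact sequence
`0 → F₁ → F₀ → Z → 0` of left `ZG`-modules with `F₀`, `F₁` flat, then every
two-generator subgroup of `G` is free. -/
theorem two_generator_subgroups_free_of_hd_le_one
    (G Z U : Type) [Group G] [Ring Z] [Ring U] [Nontrivial Z] [Nontrivial U]
    (φ : MonoidAlgebra Z G →+* U) (hφinj : Function.Injective φ)
    (hunit : ∀ a : MonoidAlgebra Z G, a ≠ 0 → IsUnit (φ a))
    (hflat : ∃ (F₁ F₀ : Type) (_ : AddCommGroup F₁)
        (_ : Module (MonoidAlgebra Z G) F₁) (_ : AddCommGroup F₀)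
        (_ : Module (MonoidAlgebra Z G) F₀)
        (f : F₁ →ₗ[MonoidAlgebra Z G] F₀)
        (e : F₀ →ₗ[MonoidAlgebra Z G] TrivialModule Z G),
        Function.Injective f ∧ Function.Surjective e ∧ Function.Exact f e ∧
        IsFlatLeftModule (MonoidAlgebra Z G) F₁ ∧
        IsFlatLeftModule (MonoidAlgebra Z G) F₀) :
    ∀ x y : G, IsFreeGroup ↥(Subgroup.closure ({x, y} : Set G)) := by
  intro x y
  obtain ⟨F₁, F₀, _, _, _, _, f, e, hf, he, hfe, h₁, h₀⟩ := hflat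
  set H := Subgroup.closure ({x, y} : Set G)
  let s : Fin 2 → H := ![⟨x, Subgroup.subset_closure (by simp)⟩,
    ⟨y, Subgroup.subset_closure (by simp)⟩]
  have hs : Subgroup.closure (Set.range s) = ⊤ := by
    rw [← Subgroup.closure_closure_coe_preimage (k := ({x, y} : Set G))]
    congr 1
    ext ⟨g, hg⟩
    simp [s, Matrix.range_cons, Subtype.ext_iff, or_comm]
  let ψ : MonoidAlgebra Z H →+* U := φ.comp (subgroupInclusion Z H)
  have hψ : Function.Injective ψ := hφinj.comp subgroupInclusion_injective
  have hψu : ∀ a, a ≠ 0 → IsUnit (ψ a) := fun a ha =>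
    hunit _ ((map_ne_zero_iff _ subgroupInclusion_injective).2 ha)
  have hcyc : (∃ t : H, ∀ g, g ∈ Subgroup.zpowers t) → IsFreeGroup H := fun ⟨t, ht⟩ =>
    isFreeGroup_of_forall_mem_zpowers ht (zpow_injective_of_isUnit hψ hψu)
  have hcyc' : ∀ i t, s i = 1 → (∀ j, j ≠ i → s j = t) → IsFreeGroup H := fun i t hi hj => by
    refine hcyc ⟨t, fun g => ?_⟩
    have hle : Subgroup.closure (Set.range s) ≤ Subgroup.zpowers t := by
      rw [Subgroup.closure_le]
      rintro _ ⟨j, rfl⟩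
      by_cases h : j = i
      · rw [h, hi]; exact one_mem _
      · rw [hj j h]; exact Subgroup.mem_zpowers t
    exact hle (hs ▸ Subgroup.mem_top g)
  by_cases hs0 : s 0 = 1
  · exact hcyc' 0 (s 1) hs0 fun j hj => by rw [Fin.eq_one_of_ne_zero j hj]
  by_cases hs1 : s 1 = 1
  · exact hcyc' 1 (s 0) hs1 fun j hj => by
      have : j = 0 := by omega
      rw [this]
  by_cases hind : ∀ a : Fin 2 → MonoidAlgebra Z H,
      ∑ i, a i * (MonoidAlgebra.single (s i) 1 - 1) = 0 → ∀ i, a i = 0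
  · exact isFreeGroup_of_independent Z s hs hind
  push Not at hind
  obtain ⟨a, hrel, i, hai⟩ := hind
  have ha1 : a 1 ≠ 0 := by
    intro ha1
    have ha0 : a 0 ≠ 0 := by
      fin_cases i
      · exact hai
      · exact absurd ha1 hai
    rw [Fin.sum_univ_two, ha1, zero_mul, add_zero] at hrel
    exact single_sub_one_ne_zero hs0 (mul_eq_zero_of_isUnit hψ hψu ha0 hrel)
  obtain ⟨J, _, c, v, hc, hv, hcv⟩ :=
    exists_eq_sum_of_relation f e hf he hfe h₁ h₀ s a hrel
  exact hcyc (exists_forall_mem_zpowers_of_relation hψ hψu hs hs0 ha1 hrel _ c v hc hv hcv)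
end

section
/- Let G be a left-orderable group (for instance, any locally indicable group) such that the trivial left ℤG-module ℤ admits a flat resolution of length at most one; that is, there is an exact sequence of left ℤG-modules 0 → F₁ → F₀ → ℤ → 0 with F₀ and F₁ flat (equivalently, the homological dimension of G is at most 1; equivalently, the augmentation ideal of ℤG is flat as a left ℤG-module). Then every subgroup of G generated by two elements is a free group. -/
/-- A group `Q` is left orderable if there is a linear order on `Q` invariant
under left multiplication. -/
def IsLeftOrderable (Q : Type) [Group Q] : Prop :=
  ∃ (_ : LinearOrder Q), ∀ g x y : Q, x ≤ y → g * x ≤ g * y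

theorem augmentationRingHom_of {G : Type} [Group G] (g : G) :
    augmentationRingHom ℤ G (MonoidAlgebra.of ℤ G g) = 1 := by
  simp [augmentationRingHom]

/-- The algebra homomorphism by which `ℤ[H]` acts on all integer-valued functions on `H`,
a group element `g` sending `f` to `h ↦ f (g⁻¹ * h)`. -/
noncomputable def translationAction (H : Type) [Group H] :
    MonoidAlgebra ℤ H →ₐ[ℤ] Module.End ℤ (H → ℤ) :=
  MonoidAlgebra.lift ℤ (Module.End ℤ (H → ℤ)) H
    { toFun := fun g => LinearMap.funLeft ℤ ℤ (fun h => g⁻¹ * h)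
      map_one' := by ext; simp [LinearMap.funLeft]
      map_mul' := fun a b => by ext; simp [LinearMap.funLeft, mul_assoc] }

theorem finite_preimage_of_strictAnti {H : Type} [LinearOrder H] {ψ : ℕ → H}
    (hψ : StrictAnti ψ) {S : Set H} (hS : S.IsPWO) : (ψ ⁻¹' S).Finite := by
  rcases (ψ ⁻¹' S).eq_empty_or_nonempty with he | hne
  · rw [he]; exact Set.finite_empty
  have hw : (ψ '' (ψ ⁻¹' S)).IsWF := (hS.mono (Set.image_preimage_subset _ _)).isWF
  obtain ⟨n, -, hn⟩ := hw.min_mem (hne.image ψ)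
  refine (Set.finite_Iic n).subset fun k hk => ?_
  have := hw.min_le (hne.image ψ) (Set.mem_image_of_mem ψ hk)
  rw [← hn] at this
  exact hψ.le_iff_ge.1 this

section TranslationAction

variable {H : Type} [Group H]

theorem translationAction_of_apply (g : H) (f : H → ℤ) (h : H) :
    translationAction H (MonoidAlgebra.of ℤ H g) f h = f (g⁻¹ * h) := by
  simp [translationAction, LinearMap.funLeft]

theorem translationAction_of_sub_one_apply (g : H) (f : H → ℤ) (h : H) :
    translationAction H (MonoidAlgebra.of ℤ H g - 1) f h = f (g⁻¹ * h) - f h := by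
  rw [map_sub, map_one, LinearMap.sub_apply, Pi.sub_apply, translationAction_of_apply]
  rfl

theorem translationAction_apply (α : MonoidAlgebra ℤ H) (f : H → ℤ) (h : H) :
    translationAction H α f h = α.coeff.sum fun g c => c * f (g⁻¹ * h) := by
  simp [translationAction, MonoidAlgebra.lift_apply, Finsupp.sum, LinearMap.sum_apply,
    Finset.sum_apply, LinearMap.funLeft]

theorem translationAction_coeff (α β : MonoidAlgebra ℤ H) :
    translationAction H α β.coeff = (α * β).coeff := by
  induction α using MonoidAlgebra.induction_linear with
  | zero => simp
  | add a b ha hb =>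
    rw [map_add, LinearMap.add_apply, ha, hb, add_mul]; rfl
  | single g c =>
    ext h
    rw [translationAction_apply, MonoidAlgebra.coeff_single, Finsupp.sum_single_index (by simp),
      MonoidAlgebra.coeff_single_mul_eq_mul_coeff (g⁻¹ * h)]
    intro m _
    rw [eq_inv_mul_iff_mul_eq]

variable [LinearOrder H] [MulLeftMono H]

theorem translationAction_ne_zero {α : MonoidAlgebra ℤ H} (hα : α ≠ 0) {f : H → ℤ}
    (hf : (Function.support f).IsPWO) (hf0 : f ≠ 0) : translationAction H α f ≠ 0 := by
  have hne : (Function.support f).Nonempty := Function.support_nonempty_iff.2 hf0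
  set m := hf.isWF.min hne with hm
  have hmf : f m ≠ 0 := hf.isWF.min_mem hne
  have hlt : ∀ h < m, f h = 0 := fun h hh => by
    by_contra hc
    exact hf.isWF.not_lt_min hne hc hh
  have hs : α.coeff.support.Nonempty := by
    rw [Finsupp.support_nonempty_iff]
    exact fun h => hα (MonoidAlgebra.coeff_injective h)
  obtain ⟨g₀, hg₀, hmin⟩ := α.coeff.support.exists_min_image (fun g => g * m) hs
  intro h0
  have h1 := congrFun h0 (g₀ * m)
  rw [translationAction_apply, Finsupp.sum, Finset.sum_eq_single_of_mem g₀ hg₀] at h1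
  · rw [inv_mul_cancel_left] at h1
    exact mul_ne_zero (Finsupp.mem_support_iff.1 hg₀) hmf h1
  · intro g hg hgg
    rw [hlt, mul_zero]
    rw [inv_mul_lt_iff_lt_mul]
    exact lt_of_le_of_ne (hmin g hg) fun h => hgg (mul_right_cancel h).symm

theorem translationAction_cancel {α : MonoidAlgebra ℤ H} (hα : α ≠ 0) {f g : H → ℤ}
    (hf : (Function.support f).IsPWO) (hg : (Function.support g).IsPWO)
    (h : translationAction H α f = translationAction H α g) : f = g := by
  by_contra hne
  refine translationAction_ne_zero hα ((hf.union hg).mono (Function.support_sub f g))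
    (sub_ne_zero.2 hne) ?_
  change translationAction H α (f - g) = 0
  rw [map_sub, h, sub_self]

theorem support_translationAction_isPWO (α : MonoidAlgebra ℤ H) {f : H → ℤ}
    (hf : (Function.support f).IsPWO) : (Function.support (translationAction H α f)).IsPWO := by
  have : Function.support (translationAction H α f) ⊆
      ⋃ g ∈ α.coeff.support, (fun h => g * h) '' Function.support f := by
    intro h hh
    rw [Function.mem_support, translationAction_apply] at hh
    obtain ⟨g, hg, hgh⟩ := Finset.exists_ne_zero_of_sum_ne_zero hh
    simp only [Set.mem_iUnion]
    exact ⟨g, hg, g⁻¹ * h, right_ne_zero_of_mul hgh, by simp⟩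
  refine Set.IsPWO.mono ?_ this
  rw [Finset.isPWO_bUnion]
  exact fun g _ => hf.image_of_monotone fun a b hab => by simpa using hab

theorem exists_translationAction_of_sub_one_eq {y : H} (hy : y ≠ 1) {w : H → ℤ}
    (hw : (Function.support w).IsPWO) :
    ∃ f : H → ℤ, (Function.support f).IsPWO ∧
      translationAction H (MonoidAlgebra.of ℤ H y - 1) f = w := by
  have hstrict : ∀ {z h : H}, z * h < h → StrictAnti fun n : ℕ => z ^ n * h := by
    intro z h hz
    refine strictAnti_nat_of_succ_lt fun n => ?_
    rw [pow_succ, mul_assoc]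
    gcongr
  have hmono : ∀ {z h : H}, h < z * h → Monotone fun n : ℕ => z ^ n * h := by
    intro z h hz
    refine monotone_nat_of_le_succ fun n => ?_
    rw [pow_succ, mul_assoc]
    gcongr
  have hup : ∀ {h : H}, h < y * h ↔ y⁻¹ * h < h := fun {h} => by rw [inv_mul_lt_iff_lt_mul]
  have hdown : ∀ {h : H}, ¬ h < y * h ↔ y * h < h := fun {h} => by
    rw [not_lt]
    refine ⟨fun hl => lt_of_le_of_ne hl fun he => hy (by simpa using he), le_of_lt⟩
  have hsum : ∀ {z h : H}, z * h < h → Summable fun n : ℕ => w (z ^ n * h) := by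
    intro z h hz
    exact summable_of_hasFiniteSupport (finite_preimage_of_strictAnti (hstrict hz) hw)
  have hsplit : ∀ {z h : H}, z * h < h →
      ∑' n : ℕ, w (z ^ n * h) = w h + ∑' n : ℕ, w (z ^ (n + 1) * h) := by
    intro z h hz
    simpa using (hsum hz).tsum_eq_zero_add
  refine ⟨fun h => if h < y * h then -∑' n : ℕ, w (y⁻¹ ^ n * h)
    else ∑' n : ℕ, w (y ^ (n + 1) * h), ?_, ?_⟩
  · have hA := ((hw.mono (Set.inter_subset_left (t := {s | s < y * s}))).prod
      (Set.isPWO_of_wellQuasiOrderedLE (Set.univ : Set ℕ))).image_of_monotoneOn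
      (f := fun p : H × ℕ => y ^ p.2 * p.1) (by
        rintro ⟨s, n⟩ ⟨⟨-, hs⟩, -⟩ ⟨s', n'⟩ - ⟨h1, h2⟩
        exact (hmono hs h2).trans (by simpa using h1))
    have hB := ((hw.mono (Set.inter_subset_left (t := {s | s < y⁻¹ * s}))).prod
      (Set.isPWO_of_wellQuasiOrderedLE (Set.univ : Set ℕ))).image_of_monotoneOn
      (f := fun p : H × ℕ => y⁻¹ ^ p.2 * p.1) (by
        rintro ⟨s, n⟩ ⟨⟨-, hs⟩, -⟩ ⟨s', n'⟩ - ⟨h1, h2⟩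
        exact (hmono hs h2).trans (by simpa using h1))
    refine (hA.union hB).mono fun h hh => ?_
    have hcomm : ∀ n : ℕ, y⁻¹ ^ n * y = y * y⁻¹ ^ n := fun n =>
      ((Commute.refl y).inv_left.pow_left n).eq
    have hcomm' : ∀ n : ℕ, y ^ n * y⁻¹ = y⁻¹ * y ^ n := fun n =>
      ((Commute.refl y).inv_right.pow_left n).eq
    rw [Function.mem_support] at hh
    by_cases hlt : h < y * h
    · left
      rw [if_pos hlt] at hh
      have : ∃ n : ℕ, w (y⁻¹ ^ n * h) ≠ 0 := by
        by_contra! hc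
        exact hh (by simp only [hc, tsum_zero, neg_zero])
      obtain ⟨n, hn⟩ := this
      refine ⟨(y⁻¹ ^ n * h, n), ⟨⟨hn, ?_⟩, trivial⟩, by simp⟩
      change y⁻¹ ^ n * h < y * (y⁻¹ ^ n * h)
      rw [← mul_assoc, ← hcomm, mul_assoc]
      gcongr
    · right
      rw [if_neg hlt] at hh
      have : ∃ n : ℕ, w (y ^ (n + 1) * h) ≠ 0 := by
        by_contra! hc
        exact hh (by simp only [hc, tsum_zero])
      obtain ⟨n, hn⟩ := this
      refine ⟨(y ^ (n + 1) * h, n + 1), ⟨⟨hn, ?_⟩, trivial⟩, by simp⟩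
      change y ^ (n + 1) * h < y⁻¹ * (y ^ (n + 1) * h)
      rw [← mul_assoc, ← hcomm', mul_assoc]
      gcongr
      rw [lt_inv_mul_iff_mul_lt]
      exact hdown.1 hlt
  · ext h
    rw [translationAction_of_sub_one_apply]
    have hiff : y⁻¹ * h < y * (y⁻¹ * h) ↔ h < y * h := by
      rw [mul_inv_cancel_left, ← hup]
    simp only [hiff]
    by_cases hlt : h < y * h
    · simp only [if_pos hlt]
      rw [hsplit (hup.1 hlt)]
      simp [pow_succ, mul_assoc]
    · simp only [if_neg hlt]
      have : ∀ n : ℕ, y ^ (n + 1) * (y⁻¹ * h) = y ^ n * h := fun n => by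
        rw [pow_succ, mul_assoc, mul_inv_cancel_left]
      simp only [this]
      rw [hsplit (hdown.1 hlt)]
      ring

theorem finite_support_inter_Iic {f : H → ℤ} (hf : (Function.support f).IsPWO)
    (hinv : ∀ g : H, (Function.support fun h => f (g⁻¹ * h) - f h).Finite) (h : H) :
    (Function.support f ∩ Set.Iic h).Finite := by
  rcases (Function.support f).eq_empty_or_nonempty with he | hne
  · simp [he]
  set m := hf.isWF.min hne with hm
  have hfin : (Function.support f ∩ Set.Iic m).Finite := by
    refine (Set.finite_singleton m).subset fun z hz => ?_
    exact le_antisymm hz.2 (hf.isWF.min_le hne hz.1)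
  refine ((hfin.image fun z => h * m⁻¹ * z).union (hinv (h * m⁻¹))).subset ?_
  rintro z ⟨hz, hzh⟩
  by_cases hd : f ((h * m⁻¹)⁻¹ * z) - f z = 0
  · left
    refine ⟨(h * m⁻¹)⁻¹ * z, ⟨?_, ?_⟩, mul_inv_cancel_left _ _⟩
    · rw [Function.mem_support, sub_eq_zero.1 hd]
      exact hz
    · rw [Set.mem_Iic, inv_mul_le_iff_le_mul]
      simpa using hzh
  · exact Or.inr hd

omit [LinearOrder H] [MulLeftMono H] in
theorem finite_support_translate_sub {S : Set H} (hgen : Subgroup.closure S = ⊤) {f : H → ℤ}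
    (hf : ∀ s ∈ S, (Function.support fun h => f (s⁻¹ * h) - f h).Finite) (g : H) :
    (Function.support fun h => f (g⁻¹ * h) - f h).Finite := by
  have hg : g ∈ Subgroup.closure S := hgen ▸ Subgroup.mem_top g
  induction hg using Subgroup.closure_induction with
  | mem s hs => exact hf s hs
  | one => simp
  | mul a b _ _ ha hb =>
    refine (ha.union (hb.image fun h => a * h)).subset fun h hh => ?_
    by_cases hd : f (a⁻¹ * h) - f h = 0
    · right
      refine ⟨a⁻¹ * h, ?_, by simp⟩
      rw [Function.mem_support] at hh ⊢
      rwa [sub_eq_zero.1 hd, ← mul_assoc, ← mul_inv_rev]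
    · exact Or.inl hd
  | inv a _ ha =>
    refine (ha.image fun h => a⁻¹ * h).subset fun h hh => ?_
    refine ⟨a * h, ?_, by simp⟩
    rw [Function.mem_support] at hh ⊢
    rw [inv_inv] at hh
    rw [inv_mul_cancel_left]
    exact fun hc => hh (by omega)

theorem exists_solution_of_relation {x y : H} (hgen : Subgroup.closure {x, y} = ⊤) (hy : y ≠ 1)
    {a b v w : MonoidAlgebra ℤ H} (ha : a ≠ 0)
    (hab : a * (MonoidAlgebra.of ℤ H x - 1) + b * (MonoidAlgebra.of ℤ H y - 1) = 0)
    (hvw : a * v + b * w = 0) :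
    ∃ f : H → ℤ, translationAction H (MonoidAlgebra.of ℤ H x - 1) f = v.coeff ∧
      translationAction H (MonoidAlgebra.of ℤ H y - 1) f = w.coeff ∧
      ∀ h, {z | f z ≠ 0 ∧ z ≤ h}.Finite := by
  have hpwo : ∀ β : MonoidAlgebra ℤ H, (Function.support β.coeff).IsPWO := fun β =>
    (Finsupp.hasFiniteSupport β.coeff).isPWO
  obtain ⟨f, hf, hyf⟩ := exists_translationAction_of_sub_one_eq hy (hpwo w)
  have hxf : translationAction H (MonoidAlgebra.of ℤ H x - 1) f = v.coeff := by
    refine translationAction_cancel ha (support_translationAction_isPWO _ hf) (hpwo v) ?_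
    have h1 := eq_neg_of_add_eq_zero_left hab
    have h2 := eq_neg_of_add_eq_zero_left hvw
    rw [← Module.End.mul_apply, ← map_mul, h1, map_neg, map_mul, LinearMap.neg_apply,
      Module.End.mul_apply, hyf, translationAction_coeff, translationAction_coeff, h2]
    rfl
  refine ⟨f, hxf, hyf, fun h => finite_support_inter_Iic hf ?_ h⟩
  refine finite_support_translate_sub hgen ?_
  rintro s (rfl | rfl)
  · simp_rw [← translationAction_of_sub_one_apply, hxf]
    exact Finsupp.hasFiniteSupport v.coeff
  · simp_rw [← translationAction_of_sub_one_apply, hyf]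
    exact Finsupp.hasFiniteSupport w.coeff

theorem exists_solution_or_finite_Icc {x y : H} (hgen : Subgroup.closure {x, y} = ⊤) (hy : y ≠ 1)
    {a b v w : MonoidAlgebra ℤ H} (ha : a ≠ 0)
    (hab : a * (MonoidAlgebra.of ℤ H x - 1) + b * (MonoidAlgebra.of ℤ H y - 1) = 0)
    (hvw : a * v + b * w = 0) :
    (∃ β : MonoidAlgebra ℤ H, (MonoidAlgebra.of ℤ H x - 1) * β = v ∧
      (MonoidAlgebra.of ℤ H y - 1) * β = w) ∨ ∀ g h : H, (Set.Icc g h).Finite := by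
  obtain ⟨f, hxf, hyf, hfin⟩ := exists_solution_of_relation hgen hy ha hab hvw
  obtain ⟨f', hxf', hyf', hfin'⟩ := @exists_solution_of_relation H _
    (inferInstanceAs (LinearOrder Hᵒᵈ)) (inferInstanceAs (MulLeftMono Hᵒᵈ))
    x y hgen hy a b v w ha hab hvw
  have hgf : ∀ g ∈ ({x, y} : Set H),
      translationAction H (MonoidAlgebra.of ℤ H g - 1) (f - f') = 0 := by
    rintro g (rfl | rfl)
    · rw [map_sub, hxf, hxf', sub_self]
    · rw [map_sub, hyf, hyf', sub_self]
  have hinv : ∀ g h : H, (f - f') (g⁻¹ * h) = (f - f') h := by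
    intro g
    have hg : g ∈ Subgroup.closure {x, y} := hgen ▸ Subgroup.mem_top g
    induction hg using Subgroup.closure_induction with
    | mem s hs =>
      intro h
      have := congrFun (hgf s hs) h
      rwa [translationAction_of_sub_one_apply, Pi.zero_apply, sub_eq_zero] at this
    | one => simp
    | mul a b _ _ ha hb => intro h; rw [mul_inv_rev, mul_assoc, hb, ha]
    | inv a _ ha => intro h; rw [inv_inv, ← ha, inv_mul_cancel_left]
  have hconst : ∀ h, f h - f' h = f 1 - f' 1 := fun h => by
    simpa using (hinv h h).symm
  by_cases hc : f 1 - f' 1 = 0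
  · left
    have hfin0 : (Function.support f).Finite := by
      refine ((hfin 1).union (hfin' 1)).subset fun z hz => ?_
      rcases le_total z 1 with h | h
      · exact Or.inl ⟨hz, h⟩
      · refine Or.inr ⟨?_, h⟩
        have := hconst z
        rw [Function.mem_support] at hz
        omega
    refine ⟨.ofCoeff (Finsupp.ofSupportFinite f hfin0),
      MonoidAlgebra.coeff_injective (DFunLike.coe_injective ?_),
      MonoidAlgebra.coeff_injective (DFunLike.coe_injective ?_)⟩
    · rw [← translationAction_coeff, ← hxf]
      rfl
    · rw [← translationAction_coeff, ← hyf]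
      rfl
  · right
    intro g h
    refine ((hfin h).union (hfin' g)).subset fun z hz => ?_
    by_cases hz0 : f z = 0
    · refine Or.inr ⟨?_, hz.1⟩
      have := hconst z
      omega
    · exact Or.inl ⟨hz0, hz.2⟩

theorem exists_one_lt_of_nontrivial [Nontrivial H] : ∃ g : H, 1 < g := by
  obtain ⟨g, hg⟩ := exists_ne (1 : H)
  rcases lt_or_gt_of_ne hg with h | h
  · exact ⟨g⁻¹, by simpa using h⟩
  · exact ⟨g, h⟩

theorem isCyclic_of_finite_Icc (hfin : ∀ g h : H, (Set.Icc g h).Finite) : IsCyclic H := by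
  rcases subsingleton_or_nontrivial H with hs | hn
  · infer_instance
  obtain ⟨g, hg⟩ := exists_one_lt_of_nontrivial (H := H)
  obtain ⟨z, ⟨hz1, hzg⟩, hzmin⟩ := ((hfin 1 g).subset
    Set.Ioc_subset_Icc_self).exists_minimal ⟨g, hg, le_rfl⟩
  have hmin : ∀ h : H, 1 < h → z ≤ h := by
    intro h hh
    by_contra! hlt
    exact absurd (hzmin ⟨hh, hlt.le.trans hzg⟩ hlt.le) (not_le.2 hlt)
  have key : ∀ n : ℕ, ∀ h : H, 1 ≤ h → (Set.Icc 1 h).ncard ≤ n → h ∈ Subgroup.zpowers z := by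
    intro n
    induction n with
    | zero =>
      intro h hh hn
      rw [Nat.le_zero, Set.ncard_eq_zero (hfin 1 h)] at hn
      exact absurd (Set.mem_Icc.2 ⟨le_rfl, hh⟩) (hn ▸ Set.notMem_empty _)
    | succ n ih =>
      intro h hh hn
      rcases hh.eq_or_lt with rfl | hlt
      · exact one_mem _
      have h1 : 1 ≤ z⁻¹ * h := by
        rw [le_inv_mul_iff_mul_le, mul_one]
        exact hmin h hlt
      suffices z⁻¹ * h ∈ Subgroup.zpowers z by
        simpa using mul_mem (Subgroup.mem_zpowers z) this
      refine ih _ h1 ?_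
      have himg : (fun k => z * k) '' Set.Icc 1 (z⁻¹ * h) ⊂ Set.Icc 1 h := by
        refine Set.ssubset_iff_of_subset ?_ |>.2 ⟨1, ⟨le_rfl, hh⟩, ?_⟩
        · rintro _ ⟨k, ⟨hk1, hk2⟩, rfl⟩
          refine ⟨hz1.le.trans (by simpa using hk1), ?_⟩
          rwa [le_inv_mul_iff_mul_le] at hk2
        · rintro ⟨k, ⟨hk1, -⟩, hk⟩
          have : z ≤ z * k := by simpa using hk1
          exact absurd (this.trans hk.le) (not_le.2 hz1)
      have := Set.ncard_lt_ncard himg (hfin 1 h)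
      rw [Set.ncard_image_of_injective _ (mul_right_injective z)] at this
      omega
  refine ⟨z, fun h => ?_⟩
  rcases le_total 1 h with hh | hh
  · exact key _ h hh le_rfl
  · have := key _ h⁻¹ (by simpa using hh) le_rfl
    exact inv_mem_iff.1 this

theorem isFreeGroup_of_isCyclic [IsCyclic H] : IsFreeGroup H := by
  rcases subsingleton_or_nontrivial H with hs | hn
  · have : Unique H := uniqueOfSubsingleton 1
    exact IsFreeGroup.ofMulEquiv (G := FreeGroup Empty) MulEquiv.ofUnique
  obtain ⟨g, hg⟩ := exists_one_lt_of_nontrivial (H := H)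
  have : Infinite H := Infinite.of_injective (fun n : ℕ => g ^ n)
    (strictMono_nat_of_lt_succ fun n => by rw [pow_succ]; simpa using hg).injective
  exact IsFreeGroup.ofMulEquiv
    ((FreeGroup.mulEquivIntOfUnique (α := Unit)).trans intCyclicMulEquiv)

theorem mul_ne_zero_of_mulLeftMono {α β : MonoidAlgebra ℤ H} (hα : α ≠ 0) (hβ : β ≠ 0) :
    α * β ≠ 0 := by
  intro h
  refine translationAction_ne_zero hα (Finsupp.hasFiniteSupport β.coeff).isPWO
    (fun h0 => hβ (MonoidAlgebra.coeff_injective (DFunLike.coe_injective h0))) ?_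
  rw [translationAction_coeff, h]
  rfl

omit [LinearOrder H] [MulLeftMono H] in
theorem of_sub_one_ne_zero {y : H} (hy : y ≠ 1) : MonoidAlgebra.of ℤ H y - 1 ≠ 0 := by
  rw [sub_ne_zero, ← map_one (MonoidAlgebra.of ℤ H)]
  exact fun h => hy (MonoidAlgebra.of_injective h)

theorem isCyclic_of_relation {x y : H} (hgen : Subgroup.closure {x, y} = ⊤) (hy : y ≠ 1)
    {a b p q r s : MonoidAlgebra ℤ H} (ha : a ≠ 0)
    (hab : a * (MonoidAlgebra.of ℤ H x - 1) + b * (MonoidAlgebra.of ℤ H y - 1) = 0)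
    (h₁ : a * p + b * r = a) (h₂ : a * q + b * s = b)
    (h₃ : r * (MonoidAlgebra.of ℤ H x - 1) + s * (MonoidAlgebra.of ℤ H y - 1) = 0) :
    IsCyclic H := by
  rcases exists_solution_or_finite_Icc hgen hy ha hab (v := 1 - p) (w := -r)
    (by rw [mul_sub, mul_neg, mul_one, sub_add, sub_neg_eq_add, h₁, sub_self])
    with ⟨β₁, -, hβ₁⟩ | h
  swap
  · exact isCyclic_of_finite_Icc h
  rcases exists_solution_or_finite_Icc hgen hy ha hab (v := -q) (w := 1 - s)
    (by rw [mul_sub, mul_neg, mul_one, neg_add_eq_sub, sub_sub, add_comm (b * s), h₂, sub_self])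
    with ⟨β₂, -, hβ₂⟩ | h
  swap
  · exact isCyclic_of_finite_Icc h
  have hz : (MonoidAlgebra.of ℤ H y - 1) * (β₁ * (MonoidAlgebra.of ℤ H x - 1) +
      β₂ * (MonoidAlgebra.of ℤ H y - 1) - 1) = 0 := by
    rw [mul_sub, mul_add, ← mul_assoc, ← mul_assoc, hβ₁, hβ₂, sub_mul, one_mul, neg_mul,
      eq_neg_of_add_eq_zero_left h₃, mul_one]
    abel
  have h1 : β₁ * (MonoidAlgebra.of ℤ H x - 1) + β₂ * (MonoidAlgebra.of ℤ H y - 1) - 1 = 0 := by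
    by_contra hc
    exact mul_ne_zero_of_mulLeftMono (of_sub_one_ne_zero hy) hc hz
  have h2 := congrArg (augmentationRingHom ℤ H) h1
  simp only [map_sub, map_add, map_mul, map_one, augmentationRingHom_of, sub_self, mul_zero,
    add_zero, zero_sub, map_zero] at h2
  norm_num at h2

end TranslationAction

section Independence

theorem exists_monoidHom_ne_one (N : Type) [Group N] [IsFreeGroup N] [Nontrivial N] :
    ∃ χ : N →* Multiplicative ℤ, ∃ n, χ n ≠ 1 := by
  have : Nonempty (IsFreeGroup.Generators N) := by
    by_contra hc
    rw [not_nonempty_iff] at hc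
    exact not_subsingleton N (IsFreeGroup.toFreeGroup N).toEquiv.subsingleton
  obtain ⟨i⟩ := this
  refine ⟨IsFreeGroup.lift fun _ => Multiplicative.ofAdd 1, IsFreeGroup.of i, ?_⟩
  rw [IsFreeGroup.lift_of]
  decide

variable {H : Type} [Group H]

theorem exists_fox_derivative {F : Type} [Group F] (π : F →* H) {u v : F}
    (δ : F → H → ℤ)
    (hδ : ∀ w w', δ (w * w') = δ w + translationAction H (MonoidAlgebra.of ℤ H (π w)) (δ w'))
    {w : F} (hw : w ∈ Subgroup.closure {u, v}) :
    ∃ a b : MonoidAlgebra ℤ H, MonoidAlgebra.of ℤ H (π w) - 1 =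
        a * (MonoidAlgebra.of ℤ H (π u) - 1) + b * (MonoidAlgebra.of ℤ H (π v) - 1) ∧
      δ w = translationAction H a (δ u) + translationAction H b (δ v) := by
  have hδ1 : δ 1 = 0 := by simpa [map_one] using hδ 1 1
  induction hw using Subgroup.closure_induction with
  | mem w hw =>
    rcases hw with rfl | rfl
    · exact ⟨1, 0, by simp, by simp⟩
    · exact ⟨0, 1, by simp, by simp⟩
  | one => exact ⟨0, 0, by rw [map_one, map_one]; simp, by simpa using hδ1⟩
  | mul w w' _ _ h h' =>
    obtain ⟨a, b, h1, h2⟩ := h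
    obtain ⟨a', b', h1', h2'⟩ := h'
    refine ⟨a + MonoidAlgebra.of ℤ H (π w) * a', b + MonoidAlgebra.of ℤ H (π w) * b', ?_, ?_⟩
    · have : MonoidAlgebra.of ℤ H (π (w * w')) - 1 = (MonoidAlgebra.of ℤ H (π w) - 1) +
          MonoidAlgebra.of ℤ H (π w) * (MonoidAlgebra.of ℤ H (π w') - 1) := by
        rw [map_mul, map_mul]; noncomm_ring
      rw [this, h1, h1']
      noncomm_ring
    · rw [hδ, h2, h2']
      simp only [map_add, map_mul, LinearMap.add_apply, Module.End.mul_apply]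
      abel
  | inv w _ h =>
    obtain ⟨a, b, h1, h2⟩ := h
    refine ⟨-MonoidAlgebra.of ℤ H (π w⁻¹) * a, -MonoidAlgebra.of ℤ H (π w⁻¹) * b, ?_, ?_⟩
    · rw [mul_assoc, mul_assoc, ← mul_add, ← h1, neg_mul, mul_sub, ← map_mul, ← map_mul,
        inv_mul_cancel, map_one, map_one, mul_one, neg_sub]
    · have h3 := hδ w⁻¹ w
      rw [inv_mul_cancel, hδ1, h2] at h3
      rw [eq_neg_of_add_eq_zero_left h3.symm]
      simp only [map_add, map_mul, map_neg, LinearMap.neg_apply, Module.End.mul_apply]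
      abel

theorem isFreeGroup_of_independent_s16 {x y : H} (hgen : Subgroup.closure {x, y} = ⊤)
    (hind : ∀ a b : MonoidAlgebra ℤ H,
      a * (MonoidAlgebra.of ℤ H x - 1) + b * (MonoidAlgebra.of ℤ H y - 1) = 0 → a = 0 ∧ b = 0) :
    IsFreeGroup H := by
  let π : FreeGroup Bool →* H := FreeGroup.lift fun i => cond i x y
  have hπt : π (FreeGroup.of true) = x := FreeGroup.lift_apply_of
  have hπf : π (FreeGroup.of false) = y := FreeGroup.lift_apply_of
  have hsurj : Function.Surjective π := by
    rw [← MonoidHom.range_eq_top, eq_top_iff, ← hgen, Subgroup.closure_le]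
    rintro _ (rfl | rfl)
    · exact ⟨_, hπt⟩
    · exact ⟨_, hπf⟩
  have hker : π.ker = ⊥ := by
    by_contra hne
    have : Nontrivial π.ker := (Subgroup.nontrivial_iff_ne_bot _).2 hne
    obtain ⟨χ, n, hn⟩ := exists_monoidHom_ne_one π.ker
    classical
    obtain ⟨σ, hσ, hσ1⟩ : ∃ σ : H → FreeGroup Bool, (∀ h, π (σ h) = h) ∧ σ 1 = 1 := by
      refine ⟨Function.update (Function.surjInv hsurj) 1 1, fun h => ?_, by simp⟩
      by_cases hh : h = 1
      · simp [hh]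
      · simp [hh, Function.surjInv_eq hsurj]
    have hmem : ∀ (w : FreeGroup Bool) (h : H), (σ h)⁻¹ * w * σ ((π w)⁻¹ * h) ∈ π.ker := by
      intro w h
      rw [MonoidHom.mem_ker]
      simp [hσ]
    let δ : FreeGroup Bool → H → ℤ := fun w h => (χ ⟨_, hmem w h⟩).toAdd
    have hδ : ∀ w w', δ (w * w') =
        δ w + translationAction H (MonoidAlgebra.of ℤ H (π w)) (δ w') := by
      intro w w'
      ext h
      rw [Pi.add_apply, translationAction_of_apply, ← toAdd_mul, ← map_mul]
      simp only [δ]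
      congr 2
      simp [mul_assoc]
    have hw : (n : FreeGroup Bool) ∈
        Subgroup.closure {FreeGroup.of true, FreeGroup.of false} := by
      have := FreeGroup.closure_range_of Bool
      rw [show Set.range (FreeGroup.of (α := Bool)) = {FreeGroup.of true, FreeGroup.of false} by
        ext; simp [or_comm]] at this
      rw [this]
      trivial
    obtain ⟨a, b, h1, h2⟩ := exists_fox_derivative π δ hδ hw
    rw [hπt, hπf, n.2, map_one, sub_self] at h1
    obtain ⟨rfl, rfl⟩ := hind a b h1.symm
    have h3 := congrFun h2 1
    simp only [map_zero, LinearMap.zero_apply, add_zero, Pi.zero_apply, δ] at h3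
    refine hn ?_
    rw [← toAdd_eq_zero, ← h3]
    congr 2
    ext
    simp [hσ1, show π n = 1 from n.2]
  exact IsFreeGroup.ofMulEquiv
    (MulEquiv.ofBijective π ⟨(MonoidHom.ker_eq_bot_iff π).1 hker, hsurj⟩)

end Independence

section Flatness

variable {A : Type} [Ring A] {ι κ : Type}

/-- The subgroup `K · M` of `Mⁿ` attached to a right submodule `K` of `Aⁿ`. -/
def rightSubmoduleSMul (M : Type) [AddCommGroup M] [Module A M]
    (K : Submodule Aᵐᵒᵖ (ι → A)) : AddSubgroup (ι → M) :=
  AddSubgroup.closure {v | ∃ c ∈ K, ∃ m : M, v = fun i => c i • m}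

/-- The map `(Aⁿ ⧸ K) × M → Mⁿ ⧸ K · M` sending `([c], m)` to the class of `c • m`. -/
noncomputable def quotientBalancedMap (M : Type) [AddCommGroup M] [Module A M]
    (K : Submodule Aᵐᵒᵖ (ι → A)) (n : (ι → A) ⧸ K) (m : M) :
    (ι → M) ⧸ rightSubmoduleSMul M K :=
  QuotientAddGroup.mk fun i => Function.surjInv (Submodule.Quotient.mk_surjective K) n i • m

variable {M : Type} [AddCommGroup M] [Module A M]

theorem quotientBalancedMap_mk (K : Submodule Aᵐᵒᵖ (ι → A)) (c : ι → A) (m : M) :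
    quotientBalancedMap M K (Submodule.Quotient.mk c) m = QuotientAddGroup.mk fun i => c i • m := by
  rw [quotientBalancedMap, QuotientAddGroup.eq]
  refine AddSubgroup.subset_closure ⟨c - Function.surjInv (Submodule.Quotient.mk_surjective K)
    (Submodule.Quotient.mk c), ?_, m, ?_⟩
  · exact (Submodule.Quotient.eq K).1
      (Function.surjInv_eq (Submodule.Quotient.mk_surjective K) _).symm
  · ext i
    simp [sub_smul, neg_add_eq_sub]

theorem isBalancedProduct_quotientBalancedMap [Fintype ι] (K : Submodule Aᵐᵒᵖ (ι → A)) :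
    IsBalancedProduct A ((ι → A) ⧸ K) M ((ι → M) ⧸ rightSubmoduleSMul M K)
      (quotientBalancedMap M K) := by
  classical
  have hsum : ∀ v : ι → M, (QuotientAddGroup.mk v : (ι → M) ⧸ rightSubmoduleSMul M K) =
      ∑ i, quotientBalancedMap M K (Submodule.Quotient.mk (Pi.single i 1)) (v i) := by
    intro v
    simp_rw [quotientBalancedMap_mk]
    have : v = ∑ i, fun j => (Pi.single i (1 : A) : ι → A) j • v i := by
      ext j
      simp [Finset.sum_apply, Pi.single_apply, ite_smul]
    conv_lhs => rw [this]
    exact map_sum (QuotientAddGroup.mk' (rightSubmoduleSMul M K)) _ _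
  refine ⟨?_, ?_, ?_, ?_⟩
  · intro n n' m
    obtain ⟨c, rfl⟩ := Submodule.Quotient.mk_surjective K n
    obtain ⟨c', rfl⟩ := Submodule.Quotient.mk_surjective K n'
    rw [← Submodule.Quotient.mk_add]
    simp only [quotientBalancedMap_mk, ← QuotientAddGroup.mk_add, Pi.add_apply, add_smul]
    rfl
  · intro n m m'
    obtain ⟨c, rfl⟩ := Submodule.Quotient.mk_surjective K n
    simp only [quotientBalancedMap_mk, ← QuotientAddGroup.mk_add, smul_add]
    rfl
  · intro n a m
    obtain ⟨c, rfl⟩ := Submodule.Quotient.mk_surjective K n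
    rw [← Submodule.Quotient.mk_smul]
    simp only [quotientBalancedMap_mk, Pi.smul_apply, MulOpposite.smul_eq_mul_unop,
      MulOpposite.unop_op, mul_smul]
  · intro T' _ b' hadd hadd' hbal
    let bl : M → ((ι → A) ⧸ K) →+ T' := fun m => AddMonoidHom.mk' (fun n => b' n m)
      fun n n' => hadd n n' m
    let br : ((ι → A) ⧸ K) → M →+ T' := fun n => AddMonoidHom.mk' (b' n) (hadd' n)
    let g₀ : (ι → M) →+ T' := ∑ i,
      (br (Submodule.Quotient.mk (Pi.single i 1))).comp (Pi.evalAddMonoidHom (fun _ => M) i)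
    have hg₀ : ∀ (c : ι → A) (m : M),
        g₀ (fun i => c i • m) = b' (Submodule.Quotient.mk c) m := by
      intro c m
      have hc : c = ∑ i, MulOpposite.op (c i) • (Pi.single i (1 : A) : ι → A) := by
        ext j
        simp [Finset.sum_apply, Pi.single_apply]
      have h1 : (Submodule.Quotient.mk c : (ι → A) ⧸ K) = ∑ i, MulOpposite.op (c i) •
          Submodule.Quotient.mk (Pi.single i (1 : A) : ι → A) := by
        conv_lhs => rw [hc]
        exact map_sum K.mkQ _ _
      have h2 : b' (Submodule.Quotient.mk c) m = bl m (Submodule.Quotient.mk c) := rfl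
      rw [h2, h1, map_sum]
      simp only [g₀, AddMonoidHom.finsetSum_apply]
      exact Finset.sum_congr rfl fun i _ => (hbal _ _ _).symm
    have hker : rightSubmoduleSMul M K ≤ g₀.ker := by
      rw [rightSubmoduleSMul, AddSubgroup.closure_le]
      rintro _ ⟨c, hc, m, rfl⟩
      change g₀ _ = 0
      rw [hg₀, (Submodule.Quotient.mk_eq_zero K).2 hc]
      exact map_zero (bl m)
    refine ⟨QuotientAddGroup.lift _ g₀ hker, ?_, ?_⟩
    · intro n m
      obtain ⟨c, rfl⟩ := Submodule.Quotient.mk_surjective K n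
      rw [quotientBalancedMap_mk]
      exact hg₀ c m
    · intro g hg
      refine DFunLike.ext _ _ fun t => ?_
      obtain ⟨v, rfl⟩ := QuotientAddGroup.mk_surjective t
      change g (QuotientAddGroup.mk v) = g₀ v
      rw [hsum, map_sum]
      simp only [hg, g₀, AddMonoidHom.finsetSum_apply]
      rfl

/-- The equational criterion: every finite system of linear relations in a flat module is a
consequence of linear relations in the ring. -/
theorem IsFlatLeftModule.exists_factorization [Fintype ι] [Fintype κ]
    (hM : IsFlatLeftModule A M) (a : κ → ι → A) (m : ι → M) (h : ∀ k, ∑ i, a k i • m i = 0) :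
    ∃ (J : Type) (_ : Fintype J) (c : ι → J → A) (m' : J → M),
      (∀ k j, ∑ i, a k i * c i j = 0) ∧ ∀ i, m i = ∑ j, c i j • m' j := by
  let l : (ι → A) →ₗ[Aᵐᵒᵖ] (κ → A) :=
    { toFun := fun c k => ∑ i, a k i * c i
      map_add' := fun c c' => by ext; simp [mul_add, Finset.sum_add_distrib]
      map_smul' := fun r c => by
        ext; simp [MulOpposite.smul_eq_mul_unop, Finset.sum_mul, mul_assoc] }
  let lM : (ι → M) →+ (κ → M) :=
    { toFun := fun v k => ∑ i, a k i • v i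
      map_zero' := by ext; simp
      map_add' := fun c c' => by ext; simp [smul_add, Finset.sum_add_distrib] }
  let j : ((ι → A) ⧸ l.ker) →ₗ[Aᵐᵒᵖ] ((κ → A) ⧸ (⊥ : Submodule Aᵐᵒᵖ (κ → A))) :=
    (Submodule.mkQ ⊥).comp (l.ker.liftQ l le_rfl)
  have hj : Function.Injective j := by
    refine Function.Injective.comp (g := Submodule.mkQ ⊥) ?_
      (LinearMap.ker_eq_bot.1 (Submodule.ker_liftQ_eq_bot' _ l rfl))
    rw [← LinearMap.ker_eq_bot, Submodule.ker_mkQ]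
  have hlM : ∀ (c : ι → A) (m : M), lM (fun i => c i • m) = fun k => l c k • m := by
    intro c m
    ext k
    simp [lM, l, Finset.sum_smul, mul_smul]
  let h' : ((ι → M) ⧸ rightSubmoduleSMul M l.ker) →+
      ((κ → M) ⧸ rightSubmoduleSMul M (⊥ : Submodule Aᵐᵒᵖ (κ → A))) :=
    QuotientAddGroup.lift _ ((QuotientAddGroup.mk' _).comp lM) (by
      rw [rightSubmoduleSMul, AddSubgroup.closure_le]
      rintro _ ⟨c, hc, m, rfl⟩
      change QuotientAddGroup.mk' _ (lM _) = 0
      rw [hlM, show l c = 0 from hc]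
      simp only [Pi.zero_apply, zero_smul]
      exact map_zero _)
  have hinj := hM _ _ _ _ _ _ j hj _ _ _ _ _ _
    (isBalancedProduct_quotientBalancedMap l.ker) (isBalancedProduct_quotientBalancedMap ⊥) h' (by
      intro n m
      obtain ⟨c, rfl⟩ := Submodule.Quotient.mk_surjective l.ker n
      rw [quotientBalancedMap_mk]
      change QuotientAddGroup.mk' _ (lM _) = quotientBalancedMap M ⊥ (Submodule.Quotient.mk (l c)) m
      rw [quotientBalancedMap_mk, hlM]
      rfl)
  have hm : (QuotientAddGroup.mk m : (ι → M) ⧸ rightSubmoduleSMul M l.ker) = 0 := by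
    refine hinj ?_
    rw [map_zero]
    change QuotientAddGroup.mk' _ (lM m) = 0
    rw [show lM m = 0 from funext h, map_zero]
  rw [QuotientAddGroup.eq_zero_iff, rightSubmoduleSMul] at hm
  clear hinj h
  induction hm using AddSubgroup.closure_induction with
  | mem v hv =>
    obtain ⟨c, hc, m, rfl⟩ := hv
    exact ⟨Unit, inferInstance, fun i _ => c i, fun _ => m, fun k _ => congrFun hc k, by simp⟩
  | zero => exact ⟨Empty, inferInstance, fun _ => Empty.elim, Empty.elim, by simp, by simp⟩
  | add v w _ _ hv hw =>
    obtain ⟨J, _, c, m, h1, h2⟩ := hv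
    obtain ⟨J', _, c', m', h1', h2'⟩ := hw
    refine ⟨J ⊕ J', inferInstance, fun i => Sum.elim (c i) (c' i), Sum.elim m m', ?_, ?_⟩
    · rintro k (j | j)
      · exact h1 k j
      · exact h1' k j
    · intro i
      simp [h2, h2']
  | neg v _ hv =>
    obtain ⟨J, _, c, m, h1, h2⟩ := hv
    exact ⟨J, inferInstance, c, -m, h1, fun i => by simp [h2]⟩

end Flatness

section FlatResolution

variable {G : Type} [Group G]

theorem augmentationRingHom_of_sub_one (g : G) :
    augmentationRingHom ℤ G (MonoidAlgebra.of ℤ G g - 1) = 0 := by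
  rw [map_sub, augmentationRingHom_of, map_one, sub_self]

/-- Over a flat resolution of length one, a relation between `g₁` and `g₂` in the augmentation
ideal factors through elements `β` of the augmentation ideal, up to a right multiplication by an
element of augmentation one. -/
theorem exists_factorization_of_flat_resolution {F₁ F₀ : Type} [AddCommGroup F₁]
    [Module (MonoidAlgebra ℤ G) F₁] [AddCommGroup F₀] [Module (MonoidAlgebra ℤ G) F₀]
    {f : F₁ →ₗ[MonoidAlgebra ℤ G] F₀} {e : F₀ →ₗ[MonoidAlgebra ℤ G] TrivialModule ℤ G}
    (hf : Function.Injective f) (he : Function.Surjective e) (hfe : Function.Exact f e)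
    (h₁ : IsFlatLeftModule (MonoidAlgebra ℤ G) F₁) (h₀ : IsFlatLeftModule (MonoidAlgebra ℤ G) F₀)
    {g₁ g₂ a b : MonoidAlgebra ℤ G} (hg₁ : augmentationRingHom ℤ G g₁ = 0)
    (hg₂ : augmentationRingHom ℤ G g₂ = 0) (hab : a * g₁ + b * g₂ = 0) :
    ∃ (J : Type) (_ : Fintype J) (c₁ c₂ β : J → MonoidAlgebra ℤ G) (α : MonoidAlgebra ℤ G),
      (∀ j, a * c₁ j + b * c₂ j = 0) ∧ augmentationRingHom ℤ G α = 1 ∧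
      (∀ j, augmentationRingHom ℤ G (β j) = 0) ∧
      g₁ * α = ∑ j, c₁ j * β j ∧ g₂ * α = ∑ j, c₂ j * β j := by
  let ε : F₀ →+ ℤ := e.toAddMonoidHom
  have hsmul : ∀ (r : MonoidAlgebra ℤ G) (n : F₀), ε (r • n) = augmentationRingHom ℤ G r * ε n :=
    fun r n => e.map_smul r n
  obtain ⟨n₀, hn₀⟩ := he (1 : ℤ)
  have hlift : ∀ g : MonoidAlgebra ℤ G, augmentationRingHom ℤ G g = 0 → ∃ u, f u = g • n₀ :=
    fun g hg => (hfe _).1 ((hsmul g n₀).trans (by rw [hg, zero_mul]; rfl))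
  obtain ⟨u, hu⟩ := hlift g₁ hg₁
  obtain ⟨v, hv⟩ := hlift g₂ hg₂
  have huv : a • u + b • v = 0 := hf (by
    rw [map_add, map_smul, map_smul, hu, hv, smul_smul, smul_smul, ← add_smul, hab, zero_smul,
      map_zero])
  obtain ⟨J, _, c, m, hc, hm⟩ := h₁.exists_factorization (ι := Bool) (κ := Unit)
    (fun _ i => cond i a b) (fun i => cond i u v) (fun _ => by simpa using huv)
  obtain ⟨L, _, γ, n, hγ, hn⟩ := h₀.exists_factorization (ι := Option J) (κ := Bool)
    (fun k i => i.elim (cond k g₁ g₂) fun j => -c k j) (fun i => i.elim n₀ fun j => f (m j)) (by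
      intro k
      have hk := hm k
      have : cond k g₁ g₂ • n₀ = ∑ j, c k j • f (m j) := by
        simp_rw [← map_smul, ← map_sum, ← hk]
        cases k
        · exact hv.symm
        · exact hu.symm
      simp [Fintype.sum_option, this])
  let z : L → ℤ := fun l => ε (n l)
  have hz : ∀ i, augmentationRingHom ℤ G (∑ l, z l • γ i l) =
      ε (i.elim n₀ fun j => f (m j)) := by
    intro i
    rw [hn i, map_sum, map_sum]
    refine Finset.sum_congr rfl fun l _ => ?_
    rw [map_zsmul]
    exact (mul_comm _ _).trans (hsmul _ _).symm
  have hrow : ∀ k, cond k g₁ g₂ * ∑ l, z l • γ none l = ∑ j, c k j * ∑ l, z l • γ (some j) l := by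
    intro k
    simp_rw [Finset.mul_sum, mul_smul_comm]
    rw [Finset.sum_comm]
    refine Finset.sum_congr rfl fun l _ => ?_
    have h := hγ k l
    rw [Fintype.sum_option] at h
    simp only [Option.elim, neg_mul, Finset.sum_neg_distrib] at h
    rw [← Finset.smul_sum, ← sub_eq_zero.1 ((sub_eq_add_neg _ _).trans h)]
  refine ⟨J, inferInstance, c true, c false, fun j => ∑ l, z l • γ (some j) l,
    ∑ l, z l • γ none l, fun j => ?_, (hz none).trans hn₀, fun j => (hz (some j)).trans ?_,
    hrow true, hrow false⟩
  · simpa using hc () j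
  · exact hfe.apply_apply_eq_zero (m j)

end FlatResolution

section Restriction

variable {G : Type} [Group G] (H : Subgroup G)

/-- The inclusion of group rings `ℤ[H] → ℤ[G]`. -/
noncomputable def groupRingInclusion : MonoidAlgebra ℤ H →+* MonoidAlgebra ℤ G :=
  MonoidAlgebra.mapDomainRingHom ℤ H.subtype

/-- A chosen representative of the coset `H * g`. -/
noncomputable def cosetRep (g : G) : G :=
  (Quotient.mk (QuotientGroup.rightRel H) g).out

theorem cosetRep_mul (h : H) (g : G) : cosetRep H (h * g) = cosetRep H g := by
  refine congrArg Quotient.out (Quotient.sound ?_)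
  change QuotientGroup.rightRel H _ _
  rw [QuotientGroup.rightRel_apply]
  simp

theorem mul_inv_cosetRep_mem (g : G) : g * (cosetRep H g)⁻¹ ∈ H :=
  QuotientGroup.rightRel_apply.1 (Quotient.exact (Quotient.out_eq _))

/-- The element `h` of `H` with `g = h * cosetRep H g`. -/
noncomputable def cosetPart (g : G) : H := ⟨g * (cosetRep H g)⁻¹, mul_inv_cosetRep_mem H g⟩

theorem cosetPart_mul (h : H) (g : G) : cosetPart H (h * g) = h * cosetPart H g :=
  Subtype.ext (by simp [cosetPart, cosetRep_mul, mul_assoc])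

theorem cosetPart_mul_cosetRep (g : G) : (cosetPart H g : G) * cosetRep H g = g := by
  simp [cosetPart]

variable {H}

/-- The additive extension to `ℤ[G]` of a function on `G`. -/
noncomputable def groupRingExtend (κ : G → MonoidAlgebra ℤ H) :
    MonoidAlgebra ℤ G →+ MonoidAlgebra ℤ H :=
  AddMonoidHom.mk' (fun v => Finsupp.linearCombination ℤ κ v.coeff) fun v w => by
    rw [MonoidAlgebra.coeff_add, map_add]

theorem groupRingExtend_single (κ : G → MonoidAlgebra ℤ H) (g : G) (n : ℤ) :
    groupRingExtend κ (MonoidAlgebra.single g n) = n • κ g := by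
  simp [groupRingExtend]

theorem groupRingInclusion_single (h : H) (n : ℤ) :
    groupRingInclusion H (MonoidAlgebra.single h n) = MonoidAlgebra.single (h : G) n := by
  simp [groupRingInclusion]

theorem groupRingInclusion_of (h : H) :
    groupRingInclusion H (MonoidAlgebra.of ℤ H h) = MonoidAlgebra.of ℤ G h :=
  groupRingInclusion_single h 1

theorem groupRingExtend_inclusion_mul {κ : G → MonoidAlgebra ℤ H}
    (hκ : ∀ (h : H) (g : G), κ (h * g) = MonoidAlgebra.of ℤ H h * κ g)
    (r : MonoidAlgebra ℤ H) (v : MonoidAlgebra ℤ G) :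
    groupRingExtend κ (groupRingInclusion H r * v) = r * groupRingExtend κ v := by
  induction r using MonoidAlgebra.induction_linear with
  | zero => simp
  | add r r' h h' => rw [map_add, add_mul, map_add, h, h', add_mul]
  | single h m =>
    induction v using MonoidAlgebra.induction_linear with
    | zero => simp
    | add v v' hv hv' => rw [mul_add, map_add, hv, hv', map_add, mul_add]
    | single g n =>
      rw [groupRingInclusion_single, MonoidAlgebra.single_mul_single, groupRingExtend_single,
        groupRingExtend_single, hκ, show MonoidAlgebra.single h m = m • MonoidAlgebra.of ℤ H h by
          simp, smul_mul_smul_comm]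

variable (H)

/-- The `ℤ[H]`-linear map `ℤ[G] → ℤ[H]` collapsing the chosen coset representatives to `1`. -/
noncomputable def cosetCollapse : MonoidAlgebra ℤ G →+ MonoidAlgebra ℤ H :=
  groupRingExtend fun g => MonoidAlgebra.of ℤ H (cosetPart H g)

open Classical in
/-- The `ℤ[H]`-coefficient of `t` in the decomposition of `ℤ[G]` along coset representatives. -/
noncomputable def cosetCoeff (t : G) : MonoidAlgebra ℤ G →+ MonoidAlgebra ℤ H :=
  groupRingExtend fun g => if cosetRep H g = t then MonoidAlgebra.of ℤ H (cosetPart H g) else 0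

variable {H}

theorem cosetCollapse_inclusion_mul (r : MonoidAlgebra ℤ H) (v : MonoidAlgebra ℤ G) :
    cosetCollapse H (groupRingInclusion H r * v) = r * cosetCollapse H v :=
  groupRingExtend_inclusion_mul (fun h g => by rw [cosetPart_mul, map_mul]) r v

theorem cosetCoeff_inclusion_mul (t : G) (r : MonoidAlgebra ℤ H) (v : MonoidAlgebra ℤ G) :
    cosetCoeff H t (groupRingInclusion H r * v) = r * cosetCoeff H t v :=
  groupRingExtend_inclusion_mul (fun h g => by
    rw [cosetPart_mul, map_mul, cosetRep_mul, mul_ite, mul_zero]) r v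

theorem augmentationRingHom_cosetCollapse (v : MonoidAlgebra ℤ G) :
    augmentationRingHom ℤ H (cosetCollapse H v) = augmentationRingHom ℤ G v := by
  induction v using MonoidAlgebra.induction_linear with
  | zero => simp
  | add v w hv hw => simp [hv, hw]
  | single g n =>
    rw [cosetCollapse, groupRingExtend_single, map_zsmul, augmentationRingHom_of]
    simp [augmentationRingHom]

theorem exists_finset_sum_cosetCoeff (v : MonoidAlgebra ℤ G) :
    ∃ S₀ : Finset G, ∀ S, S₀ ⊆ S →
      v = ∑ t ∈ S, groupRingInclusion H (cosetCoeff H t v) * MonoidAlgebra.of ℤ G t := by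
  classical
  induction v using MonoidAlgebra.induction_linear with
  | zero => exact ⟨∅, by simp⟩
  | add v w hv hw =>
    obtain ⟨S, hS⟩ := hv
    obtain ⟨S', hS'⟩ := hw
    refine ⟨S ∪ S', fun T hT => ?_⟩
    simp only [map_add, add_mul, Finset.sum_add_distrib]
    rw [← hS T (Finset.union_subset_left hT), ← hS' T (Finset.union_subset_right hT)]
  | single g n =>
    refine ⟨{cosetRep H g}, fun S hS => ?_⟩
    simp only [cosetCoeff, groupRingExtend_single]
    rw [Finset.sum_eq_single_of_mem _ (hS (Finset.mem_singleton_self _))]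
    · rw [if_pos rfl, map_zsmul, groupRingInclusion_of, smul_mul_assoc, ← map_mul,
        cosetPart_mul_cosetRep]
      simp
    · intro t _ ht
      rw [if_neg ht.symm]
      simp

/-- Every element of augmentation zero is a combination of `x - 1` and `y - 1`. -/
theorem exists_eq_of_augmentation_eq_zero {x y : G} (hgen : Subgroup.closure {x, y} = ⊤)
    {d : MonoidAlgebra ℤ G} (hd : augmentationRingHom ℤ G d = 0) :
    ∃ p q, d = p * (MonoidAlgebra.of ℤ G x - 1) + q * (MonoidAlgebra.of ℤ G y - 1) := by
  suffices h : ∀ d : MonoidAlgebra ℤ G, ∃ p q, d - augmentationRingHom ℤ G d • 1 =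
      p * (MonoidAlgebra.of ℤ G x - 1) + q * (MonoidAlgebra.of ℤ G y - 1) by
    simpa [hd] using h d
  intro d
  induction d using MonoidAlgebra.induction_linear with
  | zero => exact ⟨0, 0, by simp⟩
  | add d d' h h' =>
    obtain ⟨p, q, h⟩ := h
    obtain ⟨p', q', h'⟩ := h'
    refine ⟨p + p', q + q', ?_⟩
    rw [map_add, add_smul, add_sub_add_comm, h, h']
    noncomm_ring
  | single g n =>
    obtain ⟨p, q, h, -⟩ := exists_fox_derivative (MonoidHom.id G) (fun _ => 0)
      (fun _ _ => by simp) (hgen ▸ Subgroup.mem_top g : g ∈ Subgroup.closure {x, y})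
    refine ⟨n • p, n • q, ?_⟩
    rw [smul_mul_assoc, smul_mul_assoc, ← smul_add]
    have h' : MonoidAlgebra.single g n = n • MonoidAlgebra.of ℤ G g := by simp
    rw [h', map_zsmul, augmentationRingHom_of, smul_eq_mul, mul_one, ← smul_sub]
    exact congrArg _ h

/-- The pairs `(p * (x - 1) + q * (y - 1), r * (x - 1) + s * (y - 1))` with
`a * p + b * r = a * q + b * s = 0`. -/
def relationPairs (x y : H) (a b : MonoidAlgebra ℤ H) :
    AddSubmonoid (MonoidAlgebra ℤ H × MonoidAlgebra ℤ H) where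
  carrier := {P | ∃ p q r s, a * p + b * r = 0 ∧ a * q + b * s = 0 ∧
    P.1 = p * (MonoidAlgebra.of ℤ H x - 1) + q * (MonoidAlgebra.of ℤ H y - 1) ∧
    P.2 = r * (MonoidAlgebra.of ℤ H x - 1) + s * (MonoidAlgebra.of ℤ H y - 1)}
  zero_mem' := ⟨0, 0, 0, 0, by simp⟩
  add_mem' := by
    rintro P P' ⟨p, q, r, s, h₁, h₂, h₃, h₄⟩ ⟨p', q', r', s', h₁', h₂', h₃', h₄'⟩
    refine ⟨p + p', q + q', r + r', s + s', ?_, ?_, ?_, ?_⟩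
    · rw [mul_add, mul_add, add_add_add_comm, h₁, h₁', add_zero]
    · rw [mul_add, mul_add, add_add_add_comm, h₂, h₂', add_zero]
    · rw [Prod.fst_add, h₃, h₃', add_mul, add_mul, add_add_add_comm]
    · rw [Prod.snd_add, h₄, h₄', add_mul, add_mul, add_add_add_comm]

theorem cosetCollapse_mul_mem_relationPairs {x y : H} (hgen : Subgroup.closure {x, y} = ⊤)
    {a b : MonoidAlgebra ℤ H} {c₁ c₂ β : MonoidAlgebra ℤ G}
    (hc : groupRingInclusion H a * c₁ + groupRingInclusion H b * c₂ = 0)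
    (hβ : augmentationRingHom ℤ G β = 0) :
    (cosetCollapse H (c₁ * β), cosetCollapse H (c₂ * β)) ∈ relationPairs x y a b := by
  classical
  obtain ⟨S₁, hS₁⟩ := exists_finset_sum_cosetCoeff (H := H) c₁
  obtain ⟨S₂, hS₂⟩ := exists_finset_sum_cosetCoeff (H := H) c₂
  have hsum : ∀ c : MonoidAlgebra ℤ G,
      c = ∑ t ∈ S₁ ∪ S₂, groupRingInclusion H (cosetCoeff H t c) * MonoidAlgebra.of ℤ G t →
      cosetCollapse H (c * β) =
        ∑ t ∈ S₁ ∪ S₂, cosetCoeff H t c * cosetCollapse H (MonoidAlgebra.of ℤ G t * β) := by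
    intro c h
    conv_lhs => rw [h]
    simp_rw [Finset.sum_mul, map_sum, mul_assoc, cosetCollapse_inclusion_mul]
  rw [hsum c₁ (hS₁ _ Finset.subset_union_left), hsum c₂ (hS₂ _ Finset.subset_union_right),
    prod_mk_sum]
  refine sum_mem fun t _ => ?_
  obtain ⟨p, q, h⟩ := exists_eq_of_augmentation_eq_zero hgen
    (d := cosetCollapse H (MonoidAlgebra.of ℤ G t * β)) (by
      rw [augmentationRingHom_cosetCollapse, map_mul, hβ, mul_zero])
  have ht : a * cosetCoeff H t c₁ + b * cosetCoeff H t c₂ = 0 := by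
    rw [← cosetCoeff_inclusion_mul, ← cosetCoeff_inclusion_mul, ← map_add, hc, map_zero]
  refine ⟨cosetCoeff H t c₁ * p, cosetCoeff H t c₁ * q, cosetCoeff H t c₂ * p,
    cosetCoeff H t c₂ * q, ?_, ?_, ?_, ?_⟩
  · rw [← mul_assoc, ← mul_assoc, ← add_mul, ht, zero_mul]
  · rw [← mul_assoc, ← mul_assoc, ← add_mul, ht, zero_mul]
  · simp only [h, mul_add, mul_assoc]
  · simp only [h, mul_add, mul_assoc]

theorem exists_relation_matrix {x y : H} (hgen : Subgroup.closure {x, y} = ⊤)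
    {a b : MonoidAlgebra ℤ H}
    (hab : a * (MonoidAlgebra.of ℤ H x - 1) + b * (MonoidAlgebra.of ℤ H y - 1) = 0)
    {J : Type} [Fintype J] {c₁ c₂ β : J → MonoidAlgebra ℤ G} {α : MonoidAlgebra ℤ G}
    (hc : ∀ j, groupRingInclusion H a * c₁ j + groupRingInclusion H b * c₂ j = 0)
    (hα : augmentationRingHom ℤ G α = 1) (hβ : ∀ j, augmentationRingHom ℤ G (β j) = 0)
    (h₁ : (MonoidAlgebra.of ℤ G x - 1) * α = ∑ j, c₁ j * β j)
    (h₂ : (MonoidAlgebra.of ℤ G y - 1) * α = ∑ j, c₂ j * β j) :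
    ∃ p q r s, a * p + b * r = a ∧ a * q + b * s = b ∧
      r * (MonoidAlgebra.of ℤ H x - 1) + s * (MonoidAlgebra.of ℤ H y - 1) = 0 := by
  have hmem : ((MonoidAlgebra.of ℤ H x - 1) * cosetCollapse H α,
      (MonoidAlgebra.of ℤ H y - 1) * cosetCollapse H α) ∈ relationPairs x y a b := by
    have hincl : ∀ g : H, (MonoidAlgebra.of ℤ H g - 1) * cosetCollapse H α =
        cosetCollapse H ((MonoidAlgebra.of ℤ G g - 1) * α) := fun g => by
      rw [← cosetCollapse_inclusion_mul, map_sub, map_one, groupRingInclusion_of]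
    rw [hincl, hincl, h₁, h₂, map_sum, map_sum, prod_mk_sum]
    exact sum_mem fun j _ => cosetCollapse_mul_mem_relationPairs hgen (hc j) (hβ j)
  obtain ⟨p, q, r, s, hpr, hqs, hx, hy⟩ := hmem
  obtain ⟨A, B, hAB⟩ := exists_eq_of_augmentation_eq_zero hgen (d := cosetCollapse H α - 1) (by
    rw [map_sub, augmentationRingHom_cosetCollapse, hα, map_one, sub_self])
  rw [sub_eq_iff_eq_add] at hAB
  dsimp only at hx hy
  rw [hAB] at hx hy
  set X := MonoidAlgebra.of ℤ H x - 1
  set Y := MonoidAlgebra.of ℤ H y - 1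
  refine ⟨1 - (p - X * A), -(q - X * B), -(r - Y * A), 1 - (s - Y * B), ?_, ?_, ?_⟩
  · calc _ = a - (a * p + b * r) + (a * X + b * Y) * A := by noncomm_ring
      _ = a := by rw [hpr, hab, sub_zero, zero_mul, add_zero]
  · calc _ = b - (a * q + b * s) + (a * X + b * Y) * B := by noncomm_ring
      _ = b := by rw [hqs, hab, sub_zero, zero_mul, add_zero]
  · calc _ = Y * (A * X + B * Y + 1) - (r * X + s * Y) := by noncomm_ring
      _ = 0 := by rw [hy, sub_self]

end Restriction

/-- Let `G` be a left-orderable group such that the trivial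
left `ℤG`-module `ℤ` admits a flat resolution of length at most one, i.e.
there is an exact sequence `0 → F₁ → F₀ → ℤ → 0` of left `ℤG`-modules with
`F₀`, `F₁` flat (the homological dimension of `G` is at most `1`).  Then
every two-generator subgroup of `G` is free. -/
theorem two_generator_subgroups_free_of_leftOrderable_hd_le_one
    (G : Type) [Group G] (hLO : IsLeftOrderable G)
    (hflat : ∃ (F₁ F₀ : Type) (_ : AddCommGroup F₁)
        (_ : Module (MonoidAlgebra ℤ G) F₁) (_ : AddCommGroup F₀)
        (_ : Module (MonoidAlgebra ℤ G) F₀)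
        (f : F₁ →ₗ[MonoidAlgebra ℤ G] F₀)
        (e : F₀ →ₗ[MonoidAlgebra ℤ G] TrivialModule ℤ G),
        Function.Injective f ∧ Function.Surjective e ∧ Function.Exact f e ∧
        IsFlatLeftModule (MonoidAlgebra ℤ G) F₁ ∧
        IsFlatLeftModule (MonoidAlgebra ℤ G) F₀) :
    ∀ x y : G, IsFreeGroup ↥(Subgroup.closure ({x, y} : Set G)) := by
  obtain ⟨_, hle⟩ := hLO
  obtain ⟨F₁, F₀, _, _, _, _, f, e, hf, he, hfe, hF₁, hF₀⟩ := hflat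
  intro x y
  set H := Subgroup.closure ({x, y} : Set G)
  have : MulLeftMono H := ⟨fun g _ _ h => hle g _ _ h⟩
  obtain ⟨u, hu⟩ : ∃ u : H, (u : G) = x :=
    ⟨⟨x, Subgroup.subset_closure (Set.mem_insert _ _)⟩, rfl⟩
  obtain ⟨v, hv⟩ : ∃ v : H, (v : G) = y :=
    ⟨⟨y, Subgroup.subset_closure (Set.mem_insert_of_mem _ rfl)⟩, rfl⟩
  have hgen : Subgroup.closure {u, v} = (⊤ : Subgroup H) := by
    refine Subgroup.map_injective H.subtype_injective ?_
    rw [MonoidHom.map_closure, ← MonoidHom.range_eq_map, Subgroup.range_subtype, Set.image_pair]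
    change Subgroup.closure {(u : G), (v : G)} = H
    rw [hu, hv]
  by_cases hv1 : v = 1
  · have : IsCyclic H := by
      rw [hv1, Set.pair_comm, Subgroup.closure_insert_one, ← Subgroup.zpowers_eq_closure] at hgen
      exact ⟨u, (Subgroup.eq_top_iff' _).1 hgen⟩
    exact isFreeGroup_of_isCyclic
  by_cases hind : ∀ a b : MonoidAlgebra ℤ H,
      a * (MonoidAlgebra.of ℤ H u - 1) + b * (MonoidAlgebra.of ℤ H v - 1) = 0 → a = 0 ∧ b = 0
  · exact isFreeGroup_of_independent_s16 hgen hind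
  push Not at hind
  obtain ⟨a, b, hab, hne⟩ := hind
  have ha : a ≠ 0 := fun ha => by
    rw [ha, zero_mul, zero_add] at hab
    exact mul_ne_zero_of_mulLeftMono (hne ha) (of_sub_one_ne_zero hv1) hab
  obtain ⟨J, _, c₁, c₂, β, α, hc, hα, hβ, h₁, h₂⟩ :=
    exists_factorization_of_flat_resolution hf he hfe hF₁ hF₀
      (augmentationRingHom_of_sub_one (u : G)) (augmentationRingHom_of_sub_one (v : G))
      (a := groupRingInclusion H a) (b := groupRingInclusion H b) (by
        have := congrArg (groupRingInclusion H) hab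
        simpa only [map_add, map_mul, map_sub, map_one, map_zero, groupRingInclusion_of] using this)
  obtain ⟨p, q, r, s, hpr, hqs, hrs⟩ := exists_relation_matrix hgen hab hc hα hβ h₁ h₂
  have : IsCyclic H := isCyclic_of_relation hgen hv1 ha hab hpr hqs hrs
  exact isFreeGroup_of_isCyclic
end

section
/- Let G be a nontrivial group, and let Z and U be nonzero rings such that the group ring ZG is a subring of U and every nonzero element of ZG is invertible in U. Then U ⊗_{ZG} Z = 0, where Z denotes the trivial left ZG-module and U is regarded as a right ZG-module via the inclusion ZG ⊆ U. In particular H₀(G; U) = 0. -/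
/-- The augmentation `ZG → Z` as a map of left `ZG`-modules onto the trivial
module. -/
noncomputable def augmentationLinearMap (Z : Type) [Ring Z] (G : Type) [Group G] :
    MonoidAlgebra Z G →ₗ[MonoidAlgebra Z G] TrivialModule Z G where
  toFun x := (augmentationRingHom Z G x : TrivialModule Z G)
  map_add' x y := map_add _ x y
  map_smul' a x := by
    show augmentationRingHom Z G (a * x) =
      augmentationRingHom Z G a • augmentationRingHom Z G x
    rw [map_mul]
    rfl

/-- `b : U → M → T` realizes the base-changed module `U ⊗_{ZG} M` (for `U` a
ring containing the image of `A = ZG` under `φ`, `M` a left `A`-module and `T`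
a left `U`-module): `b` is biadditive, `A`-balanced and `U`-linear in the
first variable, and is universal among such maps into left `U`-modules. -/
def IsInducedTensor {A U : Type} [Ring A] [Ring U] (φ : A →+* U)
    {M : Type} [AddCommGroup M] [Module A M]
    {T : Type} [AddCommGroup T] [Module U T] (b : U → M → T) : Prop :=
  (∀ u u' m, b (u + u') m = b u m + b u' m) ∧
  (∀ u m m', b u (m + m') = b u m + b u m') ∧
  (∀ u a m, b (u * φ a) m = b u (a • m)) ∧
  (∀ u' u m, b (u' * u) m = u' • b u m) ∧
  ∀ (T' : Type) (_ : AddCommGroup T') (_ : Module U T') (b' : U → M → T'),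
    (∀ u u' m, b' (u + u') m = b' u m + b' u' m) →
    (∀ u m m', b' u (m + m') = b' u m + b' u m') →
    (∀ u a m, b' (u * φ a) m = b' u (a • m)) →
    (∀ u' u m, b' (u' * u) m = u' • b' u m) →
    ∃! g : T →ₗ[U] T', ∀ u m, g (b u m) = b' u m

theorem augmentationRingHom_single_one {Z G : Type} [Ring Z] [Group G] (g : G) :
    augmentationRingHom Z G (MonoidAlgebra.single g 1) = 1 := by
  simp [augmentationRingHom, MonoidAlgebra.liftNCRingHom]

theorem single_sub_one_smul_trivialModule {Z G : Type} [Ring Z] [Group G] (g : G)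
    (m : TrivialModule Z G) :
    (MonoidAlgebra.single g 1 - 1 : MonoidAlgebra Z G) • m = 0 := by
  change augmentationRingHom Z G (MonoidAlgebra.single g 1 - 1) * (show Z from m) = (0 : Z)
  rw [map_sub, map_one, augmentationRingHom_single_one, sub_self, zero_mul]

theorem single_sub_one_ne_zero_s17 {Z G : Type} [Ring Z] [Nontrivial Z] [Group G] {g : G}
    (hg : g ≠ 1) : (MonoidAlgebra.single g 1 - 1 : MonoidAlgebra Z G) ≠ 0 := by
  rw [sub_ne_zero]
  exact fun h => hg (MonoidAlgebra.of_injective (R := Z) (by simpa [MonoidAlgebra.one_def] using h))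

namespace IsInducedTensor

variable {A U M T : Type} [Ring A] [Ring U] {φ : A →+* U} [AddCommGroup M] [Module A M]
  [AddCommGroup T] [Module U T] {b : U → M → T}

theorem apply_zero (hb : IsInducedTensor φ b) (u : U) : b u 0 = 0 := by
  simpa using hb.2.1 u 0 0

/-- A pure tensor vanishes if its second factor is killed by a scalar that becomes a unit. -/
theorem apply_eq_zero_of_smul_eq_zero (hb : IsInducedTensor φ b) {a : A} (ha : IsUnit (φ a))
    (u : U) {m : M} (hm : a • m = 0) : b u m = 0 := by
  obtain ⟨v, hv⟩ := ha.exists_left_inv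
  calc
    b u m = b (u * v * φ a) m := by rw [mul_assoc, hv, mul_one]
    _ = 0 := by rw [hb.2.2.1, hm, hb.apply_zero]

/-- If all pure tensors vanish, then so does the tensor product. -/
theorem subsingleton_of_forall_eq_zero (hb : IsInducedTensor φ b) (h : ∀ u m, b u m = 0) :
    Subsingleton T := by
  obtain ⟨hadd, hadd', hbal, hsmul, huniv⟩ := hb
  have hid : (LinearMap.id : T →ₗ[U] T) = 0 :=
    (huniv T _ _ b hadd hadd' hbal hsmul).unique (fun _ _ => rfl) (fun u m => (h u m).symm)
  exact subsingleton_of_forall_eq 0 fun t => LinearMap.congr_fun hid t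

end IsInducedTensor

/-- Let `G` be a nontrivial group and let `Z`, `U` be
nonzero rings with `ZG` a subring of `U` (via an injective ring homomorphism
`φ`) such that every nonzero element of `ZG` becomes invertible in `U`.
Then `U ⊗_{ZG} Z = 0`, where `Z` is the trivial left `ZG`-module: every
left `U`-module `T` realizing this tensor product is zero.  In particular
`H₀(G; U) = 0`. -/
theorem tensor_trivialModule_eq_zero
    (G Z U : Type) [Group G] [Nontrivial G] [Ring Z] [Ring U]
    [Nontrivial Z] [Nontrivial U]
    (φ : MonoidAlgebra Z G →+* U) (hφinj : Function.Injective φ)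
    (hunit : ∀ a : MonoidAlgebra Z G, a ≠ 0 → IsUnit (φ a))
    (T : Type) [AddCommGroup T] [Module U T]
    (b : U → TrivialModule Z G → T) (hb : IsInducedTensor φ b) :
    Subsingleton T := by
  obtain ⟨g, hg⟩ := exists_ne (1 : G)
  refine hb.subsingleton_of_forall_eq_zero fun u m => ?_
  refine hb.apply_eq_zero_of_smul_eq_zero (hunit _ (single_sub_one_ne_zero_s17 hg)) u ?_
  exact single_sub_one_smul_trivialModule g m
end
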